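/- arXiv:2112.06738 — 3 statements merged into one kernel-verified Lean document; each statement's English description precedes it below -/
import Mathlib

section
/- The S-module D̃_m is free, with a free basis consisting of N homogeneous vector fields L^{(k)} = Σ_{i=1}^N f_i^{(k)} ∂_{x_i}, k = 1,…,N, in which every nonzero component f_i^{(k)} is homogeneous of the same degree (1/N)·Σ_{H ∈ 𝒜} m_H n_H (in particular this number is a nonnegative integer). -/
open MvPolynomial

noncomputable section

/-- Action of a matrix `M` on polynomials by linear substitution of the variables. -/
def polyActM {N : ℕ} (M : Matrix (Fin N) (Fin N) ℂ) (p : MvPolynomial (Fin N) ℂ) :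
    MvPolynomial (Fin N) ℂ :=
  MvPolynomial.aeval (fun i => ∑ j, MvPolynomial.C (M i j) * MvPolynomial.X j) p

/-- Action of `g ∈ GL_N(ℂ)` on polynomials: `(g · p)(x) = p (g⁻¹ x)`. -/
def polyAct {N : ℕ} (g : Matrix.GeneralLinearGroup (Fin N) ℂ) (p : MvPolynomial (Fin N) ℂ) :
    MvPolynomial (Fin N) ℂ :=
  polyActM (↑(g⁻¹) : Matrix (Fin N) (Fin N) ℂ) p

/-- The linear polynomial with coefficient vector `a`. -/
def linPoly {N : ℕ} (a : Fin N → ℂ) : MvPolynomial (Fin N) ℂ :=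
  ∑ i, MvPolynomial.C (a i) * MvPolynomial.X i

/-- The polynomial vector field `L = Σ f_i ∂_i` applied to a polynomial. -/
def applyVF {N : ℕ} (f : Fin N → MvPolynomial (Fin N) ℂ) (p : MvPolynomial (Fin N) ℂ) :
    MvPolynomial (Fin N) ℂ :=
  ∑ i, f i * MvPolynomial.pderiv i p

/-- `g` is a (complex) reflection. -/
def IsReflection {N : ℕ} (g : Matrix.GeneralLinearGroup (Fin N) ℂ) : Prop :=
  ((↑g : Matrix (Fin N) (Fin N) ℂ) - 1).rank = 1

namespace ReflectionArrangement

/-- The derivation `∂_y` of the polynomial ring along the constant vector `y`. -/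
def dirDeriv {N : ℕ} (y : Fin N → ℂ) :
    Derivation ℂ (MvPolynomial (Fin N) ℂ) (MvPolynomial (Fin N) ℂ) :=
  mkDerivation ℂ fun i => C (y i)

/-- Homogeneous polynomials of degree `k - 1`, interpreted as `0` when `k = 0`. -/
def loweredSubmodule (N : ℕ) : ℕ → Submodule ℂ (MvPolynomial (Fin N) ℂ)
  | 0 => ⊥
  | k + 1 => homogeneousSubmodule (Fin N) ℂ k

section Polynomials

variable {N : ℕ}

theorem linPoly_add (a b : Fin N → ℂ) : linPoly (a + b) = linPoly a + linPoly b := by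
  simp [linPoly, add_mul, Finset.sum_add_distrib]

theorem linPoly_smul (c : ℂ) (a : Fin N → ℂ) : linPoly (c • a) = C c * linPoly a := by
  simp [linPoly, Finset.mul_sum, mul_assoc]

theorem linPoly_sub (a b : Fin N → ℂ) : linPoly (a - b) = linPoly a - linPoly b := by
  simp [linPoly, sub_mul, Finset.sum_sub_distrib]

theorem linPoly_single (i : Fin N) : linPoly (Pi.single i (1 : ℂ)) = X i := by
  simp [linPoly, Pi.single_apply]

theorem coeff_linPoly (a : Fin N → ℂ) (i : Fin N) :
    coeff (Finsupp.single i 1) (linPoly a) = a i := by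
  simp [linPoly, coeff_sum, coeff_C_mul, coeff_X, Finsupp.single_left_inj]

theorem linPoly_injective : Function.Injective (linPoly (N := N)) := fun a b h => by
  ext i
  rw [← coeff_linPoly a i, h, coeff_linPoly]

theorem linPoly_ne_zero {a : Fin N → ℂ} (ha : a ≠ 0) : linPoly a ≠ 0 := fun h =>
  ha (linPoly_injective (by simpa [linPoly] using h))

theorem isHomogeneous_linPoly (a : Fin N → ℂ) : (linPoly a).IsHomogeneous 1 :=
  IsHomogeneous.sum _ _ _ fun i _ => isHomogeneous_C_mul_X _ i

theorem eval_linPoly (a v : Fin N → ℂ) : eval v (linPoly a) = ∑ i, a i * v i := by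
  simp [linPoly]

theorem dirDeriv_linPoly (y a : Fin N → ℂ) :
    dirDeriv y (linPoly a) = C (∑ i, a i * y i) := by
  simp [linPoly, dirDeriv, map_sum, mkDerivation_X]

theorem totalDegree_linPoly {a : Fin N → ℂ} (ha : a ≠ 0) : (linPoly a).totalDegree = 1 :=
  (isHomogeneous_linPoly a).totalDegree (linPoly_ne_zero ha)

theorem prime_linPoly {a : Fin N → ℂ} (ha : a ≠ 0) : Prime (linPoly a) := by
  have unit_of : ∀ u : MvPolynomial (Fin N) ℂ, u ≠ 0 → u.totalDegree = 0 → IsUnit u := by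
    intro u hu h
    rw [totalDegree_eq_zero_iff_eq_C] at h
    rw [h] at hu ⊢
    exact (IsUnit.mk0 _ fun h0 => hu (by rw [h0, C_0])).map C
  rw [← irreducible_iff_prime]
  refine ⟨fun h => ?_, fun u v h => ?_⟩
  · obtain ⟨v, hv⟩ := h.exists_right_inv
    have hd := congrArg MvPolynomial.totalDegree hv
    rw [totalDegree_mul_of_isDomain (linPoly_ne_zero ha) (by rintro rfl; simp at hv),
      totalDegree_linPoly ha, totalDegree_one] at hd
    omega
  · have h0 := linPoly_ne_zero ha
    rw [h] at h0
    have hu := left_ne_zero_of_mul h0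
    have hv := right_ne_zero_of_mul h0
    have hd := congrArg MvPolynomial.totalDegree h
    rw [totalDegree_mul_of_isDomain hu hv, totalDegree_linPoly ha] at hd
    rcases Nat.eq_zero_or_pos u.totalDegree with h1 | h1
    · exact Or.inl (unit_of u hu h1)
    · exact Or.inr (unit_of v hv (by omega))

theorem exists_eq_smul_of_linPoly_dvd {a b : Fin N → ℂ} (ha : a ≠ 0) (hb : b ≠ 0)
    (h : linPoly a ∣ linPoly b) : ∃ c : ℂ, b = c • a := by
  obtain ⟨u, hu⟩ := h
  have hu0 : u ≠ 0 := by
    rintro rfl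
    exact linPoly_ne_zero hb (by simpa using hu)
  have hd := congrArg MvPolynomial.totalDegree hu
  rw [totalDegree_mul_of_isDomain (linPoly_ne_zero ha) hu0, totalDegree_linPoly ha,
    totalDegree_linPoly hb] at hd
  have hc := (totalDegree_eq_zero_iff_eq_C (p := u)).1 (by omega)
  refine ⟨coeff 0 u, linPoly_injective ?_⟩
  rw [linPoly_smul, ← hc, hu, mul_comm]

theorem algHom_sub_dvd {ℓ : MvPolynomial (Fin N) ℂ}
    (φ : MvPolynomial (Fin N) ℂ →ₐ[ℂ] MvPolynomial (Fin N) ℂ)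
    (h : ∀ i, ℓ ∣ φ (X i) - X i) (p : MvPolynomial (Fin N) ℂ) : ℓ ∣ φ p - p := by
  have key : (Ideal.Quotient.mkₐ ℂ (Ideal.span {ℓ})).comp φ =
      Ideal.Quotient.mkₐ ℂ (Ideal.span {ℓ}) :=
    algHom_ext fun i => Ideal.Quotient.eq.2 (Ideal.mem_span_singleton.2 (h i))
  exact Ideal.mem_span_singleton.1 (Ideal.Quotient.eq.1 (DFunLike.congr_fun key p))

theorem linPoly_dvd_of_eval_eq_zero {a : Fin N → ℂ} (ha : a ≠ 0) {p : MvPolynomial (Fin N) ℂ}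
    (h : ∀ v, ∑ i, a i * v i = 0 → eval v p = 0) : linPoly a ∣ p := by
  obtain ⟨i, hi⟩ := Function.ne_iff.1 ha
  have hi : a i ≠ 0 := hi
  let b : Fin N → ℂ := Pi.single i (a i)⁻¹
  let φ : MvPolynomial (Fin N) ℂ →ₐ[ℂ] MvPolynomial (Fin N) ℂ :=
    aeval fun j => X j - C (b j) * linPoly a
  have hφ : φ p = 0 := by
    refine MvPolynomial.funext fun v => ?_
    have hev : eval v (φ p) = eval (fun j => v j - b j * ∑ i, a i * v i) p := by
      have : ((aeval v).comp φ : MvPolynomial (Fin N) ℂ →ₐ[ℂ] ℂ) =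
          aeval fun j => v j - b j * ∑ i, a i * v i :=
        algHom_ext fun j => by simp [φ, linPoly]
      simpa [aeval_eq_eval] using DFunLike.congr_fun this p
    rw [hev, map_zero]
    apply h
    have hb : ∑ j, a j * b j = 1 := by
      simp [b, Pi.single_apply, hi]
    simp only [mul_sub, Finset.sum_sub_distrib, ← mul_assoc, ← Finset.sum_mul, hb, one_mul,
      sub_self]
  have := algHom_sub_dvd (ℓ := linPoly a) φ (fun j => ⟨-C (b j), by simp [φ, mul_comm]⟩) p
  rwa [hφ, zero_sub, dvd_neg] at this

theorem mem_loweredSubmodule_of_mul {a : Fin N → ℂ} (ha : a ≠ 0) {k : ℕ}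
    {u : MvPolynomial (Fin N) ℂ} (h : (linPoly a * u).IsHomogeneous k) :
    u ∈ loweredSubmodule N k := by
  have key : ∀ d, coeff d u ≠ 0 → d.degree + 1 = k := by
    intro d hd
    by_contra hne
    have h2 : homogeneousComponent (d.degree + 1) (linPoly a * u) = 0 := by
      rw [homogeneousComponent_of_mem h, if_neg hne]
    have h3 : linPoly a * homogeneousComponent d.degree u = 0 := by
      rw [← h2]
      conv_rhs => rw [← sum_homogeneousComponent u, Finset.mul_sum, map_sum]
      have h4 : ∀ i, homogeneousComponent (d.degree + 1) (linPoly a * homogeneousComponent i u) =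
          if i = d.degree then linPoly a * homogeneousComponent i u else 0 := by
        intro i
        rw [homogeneousComponent_of_mem (n := i + 1)]
        · simp only [add_left_inj, eq_comm]
        · rw [add_comm]
          exact (isHomogeneous_linPoly a).mul (homogeneousComponent_isHomogeneous i u)
      simp only [h4, Finset.sum_ite_eq', Finset.mem_range]
      split_ifs with h5
      · rfl
      · rw [homogeneousComponent_eq_zero _ _ (by omega), mul_zero]
    rcases mul_eq_zero.1 h3 with h4 | h4
    · exact linPoly_ne_zero ha h4
    · apply hd
      have := coeff_homogeneousComponent (d.degree) u d
      rwa [h4, coeff_zero, if_pos rfl, eq_comm] at this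
  cases k with
  | zero =>
    refine (Submodule.mem_bot ℂ).2 (MvPolynomial.ext _ _ fun d => ?_)
    by_contra hd
    exact absurd (key d hd) (by omega)
  | succ k =>
    intro d hd
    have := key d hd
    have hw : Finsupp.weight 1 d = d.degree :=
      (DFunLike.congr_fun (Finsupp.degree_eq_weight_one (R := ℕ)) d).symm
    omega

theorem dirDeriv_mem_loweredSubmodule (y : Fin N → ℂ) {k : ℕ} {p : MvPolynomial (Fin N) ℂ}
    (h : p.IsHomogeneous k) : dirDeriv y p ∈ loweredSubmodule N k := by
  have hD : ∀ p, dirDeriv y p = ∑ i, C (y i) * pderiv i p := by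
    intro p
    induction p using MvPolynomial.induction_on with
    | C c => simp
    | add u v hu hv => simp [mul_add, Finset.sum_add_distrib, hu, hv]
    | mul_X u j hu =>
      simp only [Derivation.leibniz, hu, smul_eq_mul, mul_add, Finset.sum_add_distrib,
        Finset.mul_sum]
      congr 1
      · simp [dirDeriv, mkDerivation_X, pderiv_X, Pi.single_apply, mul_comm]
      · exact Finset.sum_congr rfl fun i _ => by ring
  cases k with
  | zero =>
    rw [hD, totalDegree_eq_zero_iff_eq_C.1 ((totalDegree_zero_iff_isHomogeneous (Fin N)).2 h)]
    simp [loweredSubmodule]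
  | succ k =>
    rw [hD]
    exact Submodule.sum_mem _ fun i _ => (h.pderiv (i := i)).C_mul _

theorem dirDeriv_single (i : Fin N) : dirDeriv (Pi.single i (1 : ℂ)) = pderiv i :=
  derivation_ext fun j => by
    simp [dirDeriv, mkDerivation_X, pderiv_X, Pi.single_apply, apply_ite C, eq_comm]

theorem sum_X_mul_dirDeriv_single {k : ℕ} {p : MvPolynomial (Fin N) ℂ} (h : p.IsHomogeneous k) :
    ∑ i, X i * dirDeriv (Pi.single i (1 : ℂ)) p = k • p := by
  simp only [dirDeriv_single, ← h.sum_X_mul_pderiv]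

/-- A family of polynomials that vanishes at `p` and is stable, up to a factor not vanishing
at `p`, under the derivations `∂_y` vanishes at `p + y`. -/
theorem eval_add_eq_zero_of_dirDeriv_mem_span {J : Set (MvPolynomial (Fin N) ℂ)}
    {p y : Fin N → ℂ} {q : MvPolynomial (Fin N) ℂ} (hq : eval p q ≠ 0)
    (hJ : ∀ j ∈ J, q * dirDeriv y j ∈ Ideal.span J) (hp : ∀ j ∈ J, eval p j = 0)
    {j : MvPolynomial (Fin N) ℂ} (hj : j ∈ J) : eval (p + y) j = 0 := by
  let φ : MvPolynomial (Fin N) ℂ →ₐ[ℂ] Polynomial ℂ :=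
    aeval fun i => Polynomial.C (p i) + Polynomial.C (y i) * Polynomial.X
  have heval : ∀ (t : ℂ) (u : MvPolynomial (Fin N) ℂ),
      (φ u).eval t = eval (fun i => p i + y i * t) u := by
    intro t u
    have : ((Polynomial.aeval t).comp φ : MvPolynomial (Fin N) ℂ →ₐ[ℂ] ℂ) =
        aeval fun i => p i + y i * t := algHom_ext fun i => by simp [φ]
    simpa [aeval_eq_eval, Polynomial.coe_aeval_eq_eval] using DFunLike.congr_fun this u
  have hder : ∀ u, Polynomial.derivative (φ u) = φ (dirDeriv y u) := by
    intro u
    induction u using MvPolynomial.induction_on with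
    | C c => simp [φ]
    | add u v hu hv => simp [hu, hv]
    | mul_X u i hu =>
      simp only [map_mul, Polynomial.derivative_mul, hu, Derivation.leibniz, smul_eq_mul, map_add]
      have h1 : Polynomial.derivative (φ (X i)) = φ (dirDeriv y (X i)) := by
        simp [φ, dirDeriv, mkDerivation_X]
      rw [h1]
      ring
  have hcop : ∀ k, IsCoprime (Polynomial.X ^ k) (φ q) := by
    intro k
    refine IsCoprime.pow_left ((Polynomial.irreducible_X.coprime_iff_not_dvd).2 fun h => ?_)
    rw [Polynomial.X_dvd_iff, Polynomial.coeff_zero_eq_eval_zero, heval] at h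
    exact hq (by simpa using h)
  have hdvd : ∀ k, ∀ j ∈ J, Polynomial.X ^ k ∣ φ j := by
    intro k
    induction k with
    | zero => simp
    | succ k ih =>
      intro j hj
      have hspan : ∀ u ∈ Ideal.span J, Polynomial.X ^ k ∣ φ u := by
        intro u hu
        have hle : Ideal.span J ≤ Ideal.comap φ (Ideal.span {Polynomial.X ^ k}) :=
          Ideal.span_le.2 fun v hv => Ideal.mem_comap.2 (Ideal.mem_span_singleton.2 (ih v hv))
        exact Ideal.mem_span_singleton.1 (hle hu)
      have h1 := hspan _ (hJ j hj)
      rw [map_mul, ← hder] at h1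
      have h2 := (hcop k).dvd_of_dvd_mul_left h1
      rw [Polynomial.X_pow_dvd_iff] at h2 ⊢
      intro d hd
      cases d with
      | zero =>
        rw [Polynomial.coeff_zero_eq_eval_zero, heval]
        simpa using hp j hj
      | succ d =>
        have h3 := h2 d (by omega)
        rw [Polynomial.coeff_derivative] at h3
        exact (mul_eq_zero.1 h3).resolve_right (by exact_mod_cast Nat.succ_ne_zero d)
  have h0 : φ j = 0 := by
    by_contra h
    exact absurd (Polynomial.natDegree_le_of_dvd (hdvd ((φ j).natDegree + 1) j hj) h) (by simp)
  have := heval 1 j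
  rw [h0, Polynomial.eval_zero] at this
  rw [this]
  congr 2
  ext i
  simp

end Polynomials

/-- The ring of polynomial functions on `ℂ^N`. -/
abbrev Poly (N : ℕ) := MvPolynomial (Fin N) ℂ

/-- A finite group `G` acting on the linear forms of `ℂ^N`, with finitely many hyperplanes
permuted by `G`, and for each of them a subgroup of elements fixing it pointwise. -/
structure ReflectionSystem (N : ℕ) (G A : Type) [Group G] where
  /-- the action on linear forms -/
  coact : Representation ℂ G (Fin N → ℂ)
  /-- the linear form defining a hyperplane -/
  root : A → Fin N → ℂ
  root_ne_zero : ∀ H, root H ≠ 0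
  eq_of_root_eq_smul : ∀ H H', (∃ c : ℂ, root H' = c • root H) → H = H'
  /-- the pointwise stabilizer of a hyperplane -/
  stab : A → Subgroup G
  /-- the character by which the stabilizer of a hyperplane acts on its linear form -/
  char : ∀ H, stab H →* ℂ
  coact_root : ∀ H (h : stab H), coact h (root H) = char H h • root H
  coact_sub : ∀ H (h : stab H) a, ∃ c : ℂ, coact h a - a = c • root H
  exists_char_ne_one : ∀ H, ∃ h, char H h ≠ 1
  /-- the multiplicity function -/
  mult : A → ℕ
  conj : ∀ g H, ∃ H', (∃ c : ℂ, root H' = c • coact g (root H)) ∧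
    mult H' * Nat.card (stab H') = mult H * Nat.card (stab H) ∧
    ∀ h' : stab H', ∃ h : stab H, (h : G) = g⁻¹ * h' * g

namespace ReflectionSystem

variable {N : ℕ} {G A : Type} [Group G] (R : ReflectionSystem N G A)

/-- The linear form of a hyperplane as a polynomial. -/
def lin (H : A) : Poly N := linPoly (R.root H)

/-- The exponent `m_H n_H`. -/
def expo (H : A) : ℕ := R.mult H * Nat.card (R.stab H)

theorem prime_lin (H : A) : Prime (R.lin H) := prime_linPoly (R.root_ne_zero H)

theorem lin_ne_zero (H : A) : R.lin H ≠ 0 := (R.prime_lin H).ne_zero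

theorem not_lin_dvd_lin {H H' : A} (h : H ≠ H') : ¬R.lin H ∣ R.lin H' := fun hd =>
  h (R.eq_of_root_eq_smul H H'
    (exists_eq_smul_of_linPoly_dvd (R.root_ne_zero H) (R.root_ne_zero H') hd))

/-- The action of the group on polynomials. -/
def act (g : G) : Poly N →ₐ[ℂ] Poly N :=
  aeval fun i => linPoly (R.coact g (Pi.single i 1))

theorem act_linPoly (g : G) (a : Fin N → ℂ) :
    R.act g (linPoly a) = linPoly (R.coact g a) := by
  have h : (Finset.univ.sum fun i => a i • (Pi.single i (1 : ℂ) : Fin N → ℂ)) = a := by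
    ext j
    simp [Finset.sum_apply, Pi.single_apply]
  have hs : ∀ s : Finset (Fin N), linPoly (∑ i ∈ s, a i • R.coact g (Pi.single i (1 : ℂ))) =
      ∑ i ∈ s, C (a i) * linPoly (R.coact g (Pi.single i (1 : ℂ))) := by
    intro s
    induction s using Finset.cons_induction with
    | empty => simp [linPoly]
    | cons i s hi ih => rw [Finset.sum_cons, Finset.sum_cons, linPoly_add, linPoly_smul, ih]
  conv_rhs => rw [← h, map_sum]
  simp only [map_smul, hs]
  simp [act, linPoly]

theorem act_one (p : Poly N) : R.act 1 p = p := by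
  have : R.act 1 = AlgHom.id ℂ (Poly N) :=
    algHom_ext fun i => by rw [← linPoly_single, act_linPoly]; simp
  simp [this]

theorem act_mul (g g' : G) (p : Poly N) : R.act (g * g') p = R.act g (R.act g' p) := by
  have : R.act (g * g') = (R.act g).comp (R.act g') :=
    algHom_ext fun i => by simp [← linPoly_single, act_linPoly]
  simp [this]

theorem act_eq_zero_iff (g : G) {p : Poly N} : R.act g p = 0 ↔ p = 0 := by
  refine ⟨fun h => ?_, fun h => by rw [h, map_zero]⟩
  rw [← R.act_one p, ← inv_mul_cancel g, act_mul, h, map_zero]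

/-- The action of the group on polynomials, as a representation. -/
def actRep : Representation ℂ G (Poly N) where
  toFun g := (R.act g).toLinearMap
  map_one' := LinearMap.ext R.act_one
  map_mul' g g' := LinearMap.ext (R.act_mul g g')

theorem isHomogeneous_act {k : ℕ} (g : G) {p : Poly N} (h : p.IsHomogeneous k) :
    (R.act g p).IsHomogeneous k := by
  have := h.aeval (fun i => linPoly (R.coact g (Pi.single i 1))) fun i => isHomogeneous_linPoly _
  rwa [one_mul] at this

theorem lin_dvd_act_sub (H : A) (h : R.stab H) (p : Poly N) :
    R.lin H ∣ R.act h p - p := by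
  refine algHom_sub_dvd _ (fun i => ?_) p
  obtain ⟨c, hc⟩ := R.coact_sub H h (Pi.single i 1)
  rw [← linPoly_single, act_linPoly, ← linPoly_sub, hc, linPoly_smul]
  exact Dvd.intro_left _ rfl

theorem act_lin (H : A) (h : R.stab H) : R.act h (R.lin H) = C (R.char H h) * R.lin H := by
  rw [lin, act_linPoly, coact_root, linPoly_smul]

theorem char_inv_mul (H : A) (h : R.stab H) : R.char H h * R.char H h⁻¹ = 1 := by
  rw [← map_mul, mul_inv_cancel, map_one]

theorem char_pow_expo (H : A) (h : R.stab H) : R.char H h ^ R.expo H = 1 := by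
  rw [← map_pow, expo, mul_comm, pow_mul, pow_card_eq_one', one_pow, map_one]

/-- A linear map dividing multiples of the linear form of `H` by it. -/
def divLin (H : A) : Poly N →ₗ[ℂ] Poly N :=
  (LinearMap.exists_leftInverse_of_injective (LinearMap.mulLeft ℂ (R.lin H))
    (LinearMap.ker_eq_bot.2 (mul_right_injective₀ (R.lin_ne_zero H)))).choose

theorem divLin_lin_mul (H : A) (u : Poly N) : R.divLin H (R.lin H * u) = u :=
  LinearMap.congr_fun (LinearMap.exists_leftInverse_of_injective (LinearMap.mulLeft ℂ (R.lin H))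
    (LinearMap.ker_eq_bot.2 (mul_right_injective₀ (R.lin_ne_zero H)))).choose_spec u

theorem lin_mul_divLin {H : A} {u : Poly N} (h : R.lin H ∣ u) :
    R.lin H * R.divLin H u = u := by
  obtain ⟨v, rfl⟩ := h
  rw [divLin_lin_mul]

section Finite

variable [Finite G]

instance (H : A) : Fintype (R.stab H) := Fintype.ofFinite _

theorem natCard_stab_pos (H : A) : 0 < Nat.card (R.stab H) := Nat.card_pos

theorem sum_char_mul_pow_eq_zero_or (H : A) (j : ℕ) :
    ∑ h, R.char H h ^ j = 0 ∨ ∑ h, R.char H h ^ j = Nat.card (R.stab H) := by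
  by_cases hj : ∀ h, R.char H h ^ j = 1
  · right
    simp [hj, Nat.card_eq_fintype_card]
  · left
    push Not at hj
    obtain ⟨g, hg⟩ := hj
    have h1 : R.char H g ^ j * ∑ h, R.char H h ^ j = ∑ h, R.char H h ^ j := by
      rw [Finset.mul_sum]
      exact Fintype.sum_equiv (Equiv.mulLeft g) _ _ fun h => by simp [mul_pow]
    have h2 : (R.char H g ^ j - 1) * ∑ h, R.char H h ^ j = 0 := by
      rw [sub_mul, one_mul, h1, sub_self]
    exact (mul_eq_zero.1 h2).resolve_left (sub_ne_zero.2 hg)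

theorem sum_char_eq_zero (H : A) : ∑ h, R.char H h = 0 := by
  obtain ⟨g, hg⟩ := R.exists_char_ne_one H
  have h1 : R.char H g * ∑ h, R.char H h = ∑ h, R.char H h := by
    rw [Finset.mul_sum]
    exact Fintype.sum_equiv (Equiv.mulLeft g) _ _ fun h => by simp
  have h2 : (R.char H g - 1) * ∑ h, R.char H h = 0 := by
    rw [sub_mul, one_mul, h1, sub_self]
  exact (mul_eq_zero.1 h2).resolve_left (sub_ne_zero.2 hg)

end Finite

end ReflectionSystem

namespace ReflectionSystem

variable {N : ℕ} {G A : Type} [Group G] (R : ReflectionSystem N G A)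
  {V V' : Type} [AddCommGroup V] [Module ℂ V] [AddCommGroup V'] [Module ℂ V']
  (ρ : Representation ℂ G V) (ρ' : Representation ℂ G V')

/-- The action of `G` on linear maps from a representation to polynomials. -/
def hom : Representation ℂ G (V →ₗ[ℂ] Poly N) := ρ.linHom R.actRep

theorem hom_apply (g : G) (f : V →ₗ[ℂ] Poly N) (x : V) :
    R.hom ρ g f x = R.act g (f (ρ g⁻¹ x)) := rfl

/-- The eigenvectors of the stabilizer of `H` with the same character as the linear form. -/
def eigen (H : A) : Submodule ℂ V where
  carrier := {x | ∀ h : R.stab H, ρ h x = R.char H h • x}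
  zero_mem' h := by simp
  add_mem' hx hy h := by rw [map_add, hx h, hy h, smul_add]
  smul_mem' c x hx h := by rw [map_smul, hx h, smul_comm]

/-- The linear maps with the divisibility property defining logarithmic vector fields. -/
def logHom : Submodule ℂ (V →ₗ[ℂ] Poly N) where
  carrier := {f | ∀ H, ∀ x ∈ R.eigen ρ H, R.lin H ^ R.expo H ∣ f x}
  zero_mem' H x _ := dvd_zero _
  add_mem' hf hg H x hx := dvd_add (hf H x hx) (hg H x hx)
  smul_mem' c _ hf H x hx := by
    rw [LinearMap.smul_apply, smul_eq_C_mul]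
    exact (hf H x hx).mul_left _

theorem hom_mem_logHom (g : G) {f : V →ₗ[ℂ] Poly N} (hf : f ∈ R.logHom ρ) :
    R.hom ρ g f ∈ R.logHom ρ := by
  intro H x hx
  obtain ⟨H', ⟨c, hc⟩, hexpo, hstab⟩ := R.conj g⁻¹ H
  have hroot : R.coact g (R.root H') = c • R.root H := by
    rw [hc, map_smul, ← Module.End.mul_apply, ← map_mul, mul_inv_cancel, map_one,
      Module.End.one_apply]
  have hmem : ρ g⁻¹ x ∈ R.eigen ρ H' := by
    intro h'
    obtain ⟨h, hh⟩ := hstab h'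
    have hh' : (h' : G) * g⁻¹ = g⁻¹ * h := by rw [hh]; group
    have hchar : R.char H' h' = R.char H h := by
      have h1 := R.coact_root H' h'
      rw [hc, map_smul, ← Module.End.mul_apply, ← map_mul, hh', map_mul, Module.End.mul_apply,
        coact_root, map_smul, smul_comm c, ← hc] at h1
      exact (smul_left_injective ℂ (R.root_ne_zero H') h1).symm
    rw [← Module.End.mul_apply, ← map_mul, hh', map_mul, Module.End.mul_apply, hx h, map_smul,
      hchar]
  obtain ⟨u, hu⟩ := hf H' _ hmem
  have hexpo : R.expo H' = R.expo H := hexpo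
  have hlin : R.act g (R.lin H') = C c * R.lin H := by
    rw [lin, act_linPoly, hroot, linPoly_smul, lin]
  rw [hom_apply, hu, map_mul, map_pow, hlin, hexpo, mul_pow, mul_right_comm]
  exact Dvd.intro_left _ rfl

section Finite

variable [Finite G]

/-- The unnormalized projection onto the part transforming by the inverse character under the
stabilizer of `H`. -/
def proj (H : A) : (V →ₗ[ℂ] Poly N) →ₗ[ℂ] (V →ₗ[ℂ] Poly N) :=
  ∑ h : R.stab H, R.char H h • R.hom ρ h

theorem proj_apply (H : A) (f : V →ₗ[ℂ] Poly N) (x : V) :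
    R.proj ρ H f x = ∑ h : R.stab H, R.char H h • R.act h (f (ρ (h : G)⁻¹ x)) := by
  simp [proj, hom_apply, LinearMap.sum_apply]

theorem proj_mem {H : A} {P : Submodule ℂ (V →ₗ[ℂ] Poly N)} {f : V →ₗ[ℂ] Poly N}
    (h : ∀ g, R.hom ρ g f ∈ P) : R.proj ρ H f ∈ P := by
  rw [proj, LinearMap.sum_apply]
  exact Submodule.sum_mem _ fun g _ => Submodule.smul_mem _ _ (h g)

theorem lin_dvd_proj {f : V →ₗ[ℂ] Poly N} (hf : f ∈ R.logHom ρ) {H : A} (hH : R.mult H ≠ 0)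
    (x : V) : R.lin H ∣ R.proj ρ H f x := by
  let z : V := ∑ h : R.stab H, R.char H h • ρ (h : G)⁻¹ x
  have hz : z ∈ R.eigen ρ H := by
    intro g
    simp only [z, map_sum, map_smul, Finset.smul_sum, smul_smul]
    refine Fintype.sum_equiv (Equiv.mulRight g⁻¹) _ _ fun h => ?_
    rw [← Module.End.mul_apply, ← map_mul]
    congr 1
    · simp only [Equiv.coe_mulRight, map_mul]
      rw [mul_left_comm, R.char_inv_mul, mul_one]
    · simp
  have hdvd : R.lin H ∣ f z :=
    (dvd_pow_self _ (mul_ne_zero hH (R.natCard_stab_pos H).ne')).trans (hf H z hz)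
  have heq : R.proj ρ H f x = f z + ∑ h : R.stab H,
      R.char H h • (R.act h (f (ρ (h : G)⁻¹ x)) - f (ρ (h : G)⁻¹ x)) := by
    simp [proj_apply, z, smul_sub, Finset.sum_sub_distrib]
  rw [heq]
  refine dvd_add hdvd (Finset.dvd_sum fun h _ => ?_)
  rw [smul_eq_C_mul]
  exact (R.lin_dvd_act_sub H h _).mul_left _

theorem mult_smul_lin_mul_divLin {f : V →ₗ[ℂ] Poly N} (hf : f ∈ R.logHom ρ) (H : A) (x : V) :
    R.mult H • (R.lin H * R.divLin H (R.proj ρ H f x)) = R.mult H • R.proj ρ H f x := by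
  by_cases hH : R.mult H = 0
  · simp [hH]
  · rw [R.lin_mul_divLin (R.lin_dvd_proj ρ hf hH x)]

/-- On eigenvectors, the projection is given by averaging the quotient by the linear form. -/
theorem proj_apply_of_mem_eigen {H : A} {x : V} (hx : x ∈ R.eigen ρ H) {f : V →ₗ[ℂ] Poly N}
    {j : ℕ} {u : Poly N} (hu : f x = R.lin H ^ j * u) :
    R.proj ρ H f x = R.lin H ^ j * ∑ h : R.stab H, R.char H h ^ j • R.act h u := by
  rw [proj_apply, Finset.mul_sum]
  refine Finset.sum_congr rfl fun h _ => ?_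
  have h1 := hx h⁻¹
  rw [InvMemClass.coe_inv] at h1
  rw [h1, map_smul, map_smul, smul_smul, char_inv_mul, one_smul, hu, map_mul, map_pow, act_lin,
    mul_pow, smul_eq_C_mul, map_pow]
  ring

variable [Fintype A]

/-- The Dunkl operator in direction `y`. -/
def dunkl (y : Fin N → ℂ) : (V →ₗ[ℂ] Poly N) →ₗ[ℂ] (V →ₗ[ℂ] Poly N) :=
  LinearMap.compRight ℂ (dirDeriv y).toLinearMap -
    ∑ H, ((R.mult H : ℂ) * ∑ i, R.root H i * y i) • LinearMap.compRight ℂ (R.divLin H) ∘ₗ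
      R.proj ρ H

theorem dunkl_apply (y : Fin N → ℂ) (f : V →ₗ[ℂ] Poly N) (x : V) :
    R.dunkl ρ y f x = dirDeriv y (f x) -
      ∑ H, ((R.mult H : ℂ) * ∑ i, R.root H i * y i) • R.divLin H (R.proj ρ H f x) := by
  simp [dunkl, LinearMap.sum_apply]

theorem dunkl_mem_logHom (y : Fin N → ℂ) {f : V →ₗ[ℂ] Poly N} (hf : f ∈ R.logHom ρ) :
    R.dunkl ρ y f ∈ R.logHom ρ := by
  classical
  intro H x hx
  by_cases hH : R.mult H = 0
  · simp [expo, hH]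
  obtain ⟨u, hu⟩ := hf H x hx
  rw [dunkl_apply, ← Finset.add_sum_erase _ _ (Finset.mem_univ H), sub_add_eq_sub_sub]
  refine dvd_sub ?_ (Finset.dvd_sum fun H' hH' => ?_)
  · obtain ⟨j, hj⟩ := Nat.exists_eq_succ_of_ne_zero
      (mul_ne_zero hH (R.natCard_stab_pos H).ne')
    have hj : R.expo H = j + 1 := hj
    have hsum : ∑ h : R.stab H, R.char H h ^ R.expo H • R.act h u =
        ∑ h : R.stab H, (R.act h u - u) + C (Nat.card (R.stab H) : ℂ) * u := by
      simp [char_pow_expo, Finset.sum_sub_distrib, Nat.card_eq_fintype_card]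
    obtain ⟨w, hw⟩ : R.lin H ∣ ∑ h : R.stab H, (R.act h u - u) :=
      Finset.dvd_sum fun h _ => R.lin_dvd_act_sub H h u
    have hdiv : R.divLin H (R.proj ρ H f x) =
        R.lin H ^ j * (R.lin H * w + C (Nat.card (R.stab H) : ℂ) * u) := by
      rw [R.proj_apply_of_mem_eigen ρ hx hu, hsum, hw, ← R.divLin_lin_mul H (R.lin H ^ j * _), hj]
      congr 1
      ring
    have hexpo : ((j : Poly N) + 1) = C (R.mult H : ℂ) * C (Nat.card (R.stab H) : ℂ) := by
      have h1 : ((j + 1 : ℕ) : Poly N) = ((R.mult H * Nat.card (R.stab H) : ℕ) : Poly N) := by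
        rw [← hj, expo]
      simpa using h1
    rw [hdiv, hu, hj, Derivation.leibniz, Derivation.leibniz_pow, lin, dirDeriv_linPoly, ← lin,
      smul_eq_C_mul, Nat.add_sub_cancel]
    refine ⟨dirDeriv y u - C ((R.mult H : ℂ) * ∑ i, R.root H i * y i) * w, ?_⟩
    simp only [smul_eq_mul, nsmul_eq_mul, C_mul, Nat.cast_add, Nat.cast_one, hexpo]
    ring
  · by_cases hm : R.mult H' = 0
    · simp [hm]
    rw [smul_eq_C_mul]
    refine Dvd.dvd.mul_left ?_ _
    have h1 := R.proj_mem ρ (H := H') (fun g => R.hom_mem_logHom ρ g hf) H x hx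
    rw [← R.lin_mul_divLin (R.lin_dvd_proj ρ hf hm x)] at h1
    exact (R.prime_lin H).pow_dvd_of_dvd_mul_left _
      (R.not_lin_dvd_lin (Finset.ne_of_mem_erase hH').symm) h1

/-- Linear maps to homogeneous polynomials of degree `k`. -/
def homogHom (V : Type) [AddCommGroup V] [Module ℂ V] (N k : ℕ) :
    Submodule ℂ (V →ₗ[ℂ] Poly N) where
  carrier := {f | ∀ x, f x ∈ homogeneousSubmodule (Fin N) ℂ k}
  zero_mem' _ := Submodule.zero_mem _
  add_mem' hf hg x := Submodule.add_mem _ (hf x) (hg x)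
  smul_mem' c _ hf x := Submodule.smul_mem _ c (hf x)

theorem dunkl_apply_mem (y : Fin N → ℂ) {f : V →ₗ[ℂ] Poly N} (hf : f ∈ R.logHom ρ) {k : ℕ}
    (hk : f ∈ homogHom V N k) (x : V) : R.dunkl ρ y f x ∈ loweredSubmodule N k := by
  rw [dunkl_apply]
  refine Submodule.sub_mem _ (dirDeriv_mem_loweredSubmodule y (hk x))
    (Submodule.sum_mem _ fun H _ => ?_)
  by_cases hm : R.mult H = 0
  · simp [hm]
  refine Submodule.smul_mem _ _ (mem_loweredSubmodule_of_mul (R.root_ne_zero H) ?_)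
  rw [← lin, R.lin_mul_divLin (R.lin_dvd_proj ρ hf hm x), proj_apply]
  exact IsHomogeneous.sum _ _ _ fun h _ =>
    Submodule.smul_mem (homogeneousSubmodule (Fin N) ℂ k) _ (R.isHomogeneous_act _ (hk _))

theorem dunkl_apply_eq_zero {D : Submodule ℂ V} (hD : ∀ g, ∀ x ∈ D, ρ g x ∈ D) (y : Fin N → ℂ)
    {f : V →ₗ[ℂ] Poly N} (hf : ∀ x ∈ D, f x = 0) {x : V} (hx : x ∈ D) :
    R.dunkl ρ y f x = 0 := by
  have h0 : ∀ g, f (ρ g x) = 0 := fun g => hf _ (hD g x hx)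
  simp [dunkl_apply, proj_apply, h0, hf x hx]

end Finite

end ReflectionSystem

/-- A stable subspace is the range of an equivariant projection (Maschke's theorem). -/
theorem exists_equivariant_projection {G V : Type} [Group G] [Finite G] [AddCommGroup V]
    [Module ℂ V] (ρ : Representation ℂ G V) {K : Submodule ℂ V}
    (hK : ∀ g, ∀ x ∈ K, ρ g x ∈ K) :
    ∃ P : V →ₗ[ℂ] V, (∀ x, P x ∈ K) ∧ (∀ x ∈ K, P x = x) ∧ ∀ g x, P (ρ g x) = ρ g (P x) := by
  have := Fintype.ofFinite G
  obtain ⟨p, hp⟩ := LinearMap.exists_leftInverse_of_injective K.subtype K.ker_subtype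
  have hcard : (Fintype.card G : ℂ) ≠ 0 := Nat.cast_ne_zero.2 Fintype.card_ne_zero
  have happ : ∀ x, (∑ g, ρ g ∘ₗ K.subtype ∘ₗ p ∘ₗ ρ g⁻¹) x = ∑ g, ρ g (p (ρ g⁻¹ x)) := by
    simp [LinearMap.sum_apply]
  refine ⟨(Fintype.card G : ℂ)⁻¹ • ∑ g, ρ g ∘ₗ K.subtype ∘ₗ p ∘ₗ ρ g⁻¹, fun x => ?_,
    fun x hx => ?_, fun g x => ?_⟩
  · rw [LinearMap.smul_apply, happ]
    exact K.smul_mem _ (K.sum_mem fun g _ => hK g _ (p _).2)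
  · have h1 : ∀ y ∈ K, (p y : V) = y := fun y hy =>
      congrArg Subtype.val (LinearMap.congr_fun hp ⟨y, hy⟩)
    have h2 : ∀ g, ρ g (p (ρ g⁻¹ x)) = x := fun g => by
      rw [h1 _ (hK _ _ hx), ← Module.End.mul_apply, ← map_mul, mul_inv_cancel, map_one,
        Module.End.one_apply]
    rw [LinearMap.smul_apply, happ]
    simp only [h2, Finset.sum_const, Finset.card_univ]
    rw [← Nat.cast_smul_eq_nsmul ℂ, inv_smul_smul₀ hcard]
  · rw [LinearMap.smul_apply, LinearMap.smul_apply, happ, happ, map_smul, map_sum]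
    congr 1
    refine Fintype.sum_equiv (Equiv.mulLeft g⁻¹) _ _ fun h => ?_
    simp [← Module.End.mul_apply, ← map_mul]

namespace ReflectionSystem

variable {N : ℕ} {G A : Type} [Group G] (R : ReflectionSystem N G A)
  {V V' : Type} [AddCommGroup V] [Module ℂ V] [AddCommGroup V'] [Module ℂ V']
  (ρ : Representation ℂ G V) (ρ' : Representation ℂ G V')

/-- There is a point outside of all the hyperplanes. -/
theorem exists_regular [Fintype A] : ∃ p : Fin N → ℂ, ∀ H, eval p (R.lin H) ≠ 0 := by
  by_contra! h
  refine Finset.prod_ne_zero_iff.2 (fun H (_ : H ∈ Finset.univ) => R.lin_ne_zero H)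
    (MvPolynomial.funext fun p => ?_)
  obtain ⟨H, hH⟩ := h p
  rw [map_prod, map_zero]
  exact Finset.prod_eq_zero (Finset.mem_univ H) hH

/-- Homogeneous linear maps of degree `k` with the divisibility property vanishing on `D`. -/
def gradedPart (D : Submodule ℂ V) (k : ℕ) : Submodule ℂ (V →ₗ[ℂ] Poly N) where
  carrier := {f | f ∈ R.logHom ρ ∧ f ∈ homogHom V N k ∧ ∀ x ∈ D, f x = 0}
  zero_mem' := ⟨Submodule.zero_mem _, Submodule.zero_mem _, fun _ _ => rfl⟩
  add_mem' hf hg := ⟨Submodule.add_mem _ hf.1 hg.1, Submodule.add_mem _ hf.2.1 hg.2.1,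
    fun x hx => by rw [LinearMap.add_apply, hf.2.2 x hx, hg.2.2 x hx, add_zero]⟩
  smul_mem' c _ hf := ⟨Submodule.smul_mem _ c hf.1, Submodule.smul_mem _ c hf.2.1,
    fun x hx => by rw [LinearMap.smul_apply, hf.2.2 x hx, smul_zero]⟩

variable {ρ} in
theorem hom_mem_gradedPart {D : Submodule ℂ V} (hD : ∀ g, ∀ x ∈ D, ρ g x ∈ D) {k : ℕ} (g : G)
    {f : V →ₗ[ℂ] Poly N} (hf : f ∈ R.gradedPart ρ D k) : R.hom ρ g f ∈ R.gradedPart ρ D k :=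
  ⟨R.hom_mem_logHom ρ g hf.1, fun x => R.isHomogeneous_act g (hf.2.1 _),
    fun x hx => by rw [hom_apply, hf.2.2 _ (hD _ x hx), map_zero]⟩

variable [Finite G] [Fintype A]

/-- Linear maps killed, together with all their translates, by the Dunkl operators. -/
def harm : Submodule ℂ (V →ₗ[ℂ] Poly N) where
  carrier := {f | f ∈ R.logHom ρ ∧ ∀ g y, R.dunkl ρ y (R.hom ρ g f) = 0}
  zero_mem' := ⟨Submodule.zero_mem _, fun g y => by simp⟩
  add_mem' hf hg := ⟨Submodule.add_mem _ hf.1 hg.1, fun g y => by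
    rw [map_add, map_add, hf.2, hg.2, add_zero]⟩
  smul_mem' c _ hf := ⟨Submodule.smul_mem _ c hf.1, fun g y => by
    rw [map_smul, map_smul, hf.2, smul_zero]⟩

theorem hom_mem_harm (g : G) {f : V →ₗ[ℂ] Poly N} (hf : f ∈ R.harm ρ) :
    R.hom ρ g f ∈ R.harm ρ := by
  refine ⟨R.hom_mem_logHom ρ g hf.1, fun g' y => ?_⟩
  have h := hf.2 (g' * g) y
  rwa [map_mul, Module.End.mul_apply] at h

theorem dunkl_eq_zero_of_mem_harm {f : V →ₗ[ℂ] Poly N} (hf : f ∈ R.harm ρ) (y : Fin N → ℂ) :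
    R.dunkl ρ y f = 0 := by
  have := hf.2 1 y
  rwa [map_one, Module.End.one_apply] at this

theorem dirDeriv_of_mem_harm {f : V →ₗ[ℂ] Poly N} (hf : f ∈ R.harm ρ) (y : Fin N → ℂ) (x : V) :
    dirDeriv y (f x) =
      ∑ H, ((R.mult H : ℂ) * ∑ i, R.root H i * y i) • R.divLin H (R.proj ρ H f x) := by
  have h := LinearMap.congr_fun (R.dunkl_eq_zero_of_mem_harm ρ hf y) x
  rwa [dunkl_apply, LinearMap.zero_apply, sub_eq_zero] at h

variable {ρ} in
/-- A nonzero graded part of lowest degree consists of maps killed by the Dunkl operators. -/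
theorem exists_gradedPart_le_harm {D : Submodule ℂ V} (hD : ∀ g, ∀ x ∈ D, ρ g x ∈ D)
    (htop : D ≠ ⊤) : ∃ k, R.gradedPart ρ D k ≠ ⊥ ∧ R.gradedPart ρ D k ≤ R.harm ρ := by
  classical
  have hex : ∃ k, R.gradedPart ρ D k ≠ ⊥ := by
    obtain ⟨φ, hφ, hφD⟩ := Submodule.exists_le_ker_of_lt_top D (lt_top_iff_ne_top.2 htop)
    refine ⟨∑ H, R.expo H, fun h => ?_⟩
    have hmem : φ.smulRight (∏ H, R.lin H ^ R.expo H) ∈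
        R.gradedPart ρ D (∑ H, R.expo H) := by
      refine ⟨fun H x _ => ?_, fun x => ?_, fun x hx => ?_⟩
      · rw [LinearMap.smulRight_apply, smul_eq_C_mul]
        exact (Finset.dvd_prod_of_mem _ (Finset.mem_univ H)).mul_left _
      · refine Submodule.smul_mem _ _ (IsHomogeneous.prod _ _ _ fun H _ => ?_)
        simpa [lin] using (isHomogeneous_linPoly (R.root H)).pow (R.expo H)
      · rw [LinearMap.smulRight_apply, LinearMap.mem_ker.1 (hφD hx), zero_smul]
    rw [h, Submodule.mem_bot] at hmem
    refine hφ (LinearMap.ext fun x => ?_)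
    have hx := LinearMap.congr_fun hmem x
    rw [LinearMap.smulRight_apply, LinearMap.zero_apply, smul_eq_zero] at hx
    exact hx.resolve_right (Finset.prod_ne_zero_iff.2 fun H _ => pow_ne_zero _ (R.lin_ne_zero H))
  refine ⟨Nat.find hex, Nat.find_spec hex, fun f hf => ⟨hf.1, fun g y => ?_⟩⟩
  have hg := R.hom_mem_gradedPart hD g hf
  have hlow := R.dunkl_apply_mem ρ y hg.1 hg.2.1
  generalize hk : Nat.find hex = k at hlow
  cases k with
  | zero => exact LinearMap.ext fun x => (Submodule.mem_bot ℂ).1 (hlow x)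
  | succ k =>
    have hbot : R.gradedPart ρ D k = ⊥ := not_not.1 (Nat.find_min hex (by omega))
    rw [← Submodule.mem_bot ℂ, ← hbot]
    exact ⟨R.dunkl_mem_logHom ρ y hg.1, hlow,
      fun x hx => R.dunkl_apply_eq_zero ρ hD y hg.2.2 hx⟩

variable {ρ} in
/-- A stable family of maps killed by the Dunkl operators whose values at `x` vanish at a point
`p` has values vanishing along directions tangent to the hyperplanes through `p`. -/
theorem eval_add_eq_zero {F : Set (V →ₗ[ℂ] Poly N)} (hF : F ⊆ R.harm ρ)
    (hstable : ∀ g, ∀ f ∈ F, R.hom ρ g f ∈ F) (s : Finset A) {p y : Fin N → ℂ}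
    (hp : ∀ H ∈ s, eval p (R.lin H) ≠ 0) (hy : ∀ H ∉ s, ∑ i, R.root H i * y i = 0) {x : V}
    (hx : ∀ f ∈ F, eval p (f x) = 0) {f : V →ₗ[ℂ] Poly N} (hf : f ∈ F) :
    eval (p + y) (f x) = 0 := by
  classical
  refine eval_add_eq_zero_of_dirDeriv_mem_span (J := (fun f => f x) '' F)
    (q := ∏ H ∈ s, R.lin H) ?_ ?_ ?_ (Set.mem_image_of_mem _ hf)
  · rw [map_prod]
    exact Finset.prod_ne_zero_iff.2 hp
  · rintro _ ⟨f, hf, rfl⟩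
    rw [R.dirDeriv_of_mem_harm ρ (hF hf), Finset.mul_sum]
    refine Ideal.sum_mem _ fun H _ => ?_
    by_cases hs : H ∈ s
    · have h1 := R.mult_smul_lin_mul_divLin ρ (hF hf).1 H x
      rw [nsmul_eq_mul, nsmul_eq_mul] at h1
      have h2 : (∏ H ∈ s, R.lin H) * (((R.mult H : ℂ) * ∑ i, R.root H i * y i) •
          R.divLin H (R.proj ρ H f x)) = ((∏ H ∈ s.erase H, R.lin H) *
            C (∑ i, R.root H i * y i) * (R.mult H : Poly N)) * R.proj ρ H f x := by
        rw [mul_assoc _ _ (R.proj ρ H f x), ← h1, ← Finset.mul_prod_erase s _ hs, smul_eq_C_mul,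
          C_mul, map_natCast]
        ring
      rw [h2]
      refine Ideal.mul_mem_left _ _ ?_
      rw [proj, LinearMap.sum_apply, LinearMap.sum_apply]
      refine Ideal.sum_mem _ fun h _ => ?_
      rw [LinearMap.smul_apply, LinearMap.smul_apply, smul_eq_C_mul]
      exact Ideal.mul_mem_left _ _ (Ideal.subset_span ⟨_, hstable _ f hf, rfl⟩)
    · simp [hy H hs]
  · rintro _ ⟨f, hf, rfl⟩
    exact hx f hf

variable {ρ} in
theorem apply_eq_zero_of_eval_eq_zero {F : Set (V →ₗ[ℂ] Poly N)} (hF : F ⊆ R.harm ρ)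
    (hstable : ∀ g, ∀ f ∈ F, R.hom ρ g f ∈ F) {p : Fin N → ℂ}
    (hp : ∀ H, eval p (R.lin H) ≠ 0) {x : V}
    (hx : ∀ f ∈ F, eval p (f x) = 0) {f : V →ₗ[ℂ] Poly N} (hf : f ∈ F) : f x = 0 := by
  refine MvPolynomial.funext fun v => ?_
  have := R.eval_add_eq_zero hF hstable Finset.univ (y := v - p) (fun H _ => hp H)
    (fun H h => absurd (Finset.mem_univ H) h) hx hf
  rwa [add_sub_cancel] at this

end ReflectionSystem

instance {N : ℕ} {V : Type} [AddCommGroup V] [Module ℂ V] (Y : Submodule ℂ (V →ₗ[ℂ] Poly N)) :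
    AddCommGroup Y := Submodule.addCommGroup Y

theorem finiteDimensional_and_finrank_le_of_mapsTo {M M' : Type} [AddCommGroup M] [Module ℂ M]
    [AddCommGroup M'] [Module ℂ M'] (F : M →ₗ[ℂ] M') {Y : Submodule ℂ M} {Y' : Submodule ℂ M'}
    [FiniteDimensional ℂ Y'] (hF : ∀ f ∈ Y, F f ∈ Y') (h0 : ∀ f ∈ Y, F f = 0 → f = 0) :
    FiniteDimensional ℂ Y ∧ Module.finrank ℂ Y ≤ Module.finrank ℂ Y' := by
  have hinj : Function.Injective (F.restrict hF) :=
    (injective_iff_map_eq_zero _).2 fun f hf =>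
      Subtype.ext (h0 f f.2 (congrArg Subtype.val hf))
  exact ⟨FiniteDimensional.of_injective _ hinj, LinearMap.finrank_le_finrank_of_injective hinj⟩

namespace ReflectionSystem

variable {N : ℕ} {G A : Type} [Group G] (R : ReflectionSystem N G A)
  {V V' : Type} [AddCommGroup V] [Module ℂ V] [AddCommGroup V'] [Module ℂ V']
  {ρ : Representation ℂ G V} {ρ' : Representation ℂ G V'}

theorem hom_comp {π : V →ₗ[ℂ] V'} (hπ : ∀ g x, π (ρ g x) = ρ' g (π x)) (g : G)
    (f : V' →ₗ[ℂ] Poly N) : R.hom ρ g (f ∘ₗ π) = R.hom ρ' g f ∘ₗ π :=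
  LinearMap.ext fun x => by simp [hom_apply, hπ]

theorem comp_mem_logHom {π : V →ₗ[ℂ] V'} (hπ : ∀ g x, π (ρ g x) = ρ' g (π x))
    {f : V' →ₗ[ℂ] Poly N} (hf : f ∈ R.logHom ρ') : f ∘ₗ π ∈ R.logHom ρ :=
  fun H x hx => hf H (π x) fun h => by rw [← hπ, hx h, map_smul]

variable (G) in
/-- The regular representation. -/
def regular : Representation ℂ G (G →₀ ℂ) where
  toFun g := Finsupp.lmapDomain ℂ ℂ (g * ·)
  map_one' := by ext; simp
  map_mul' g g' := by ext; simp [mul_assoc]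

theorem regular_single (g h : G) (c : ℂ) :
    regular G g (Finsupp.single h c) = Finsupp.single (g * h) c := by
  simp [regular, Finsupp.mapDomain_single]

section Finite

variable [Finite G] [Fintype A]

theorem dunkl_comp {π : V →ₗ[ℂ] V'} (hπ : ∀ g x, π (ρ g x) = ρ' g (π x)) (y : Fin N → ℂ)
    (f : V' →ₗ[ℂ] Poly N) : R.dunkl ρ y (f ∘ₗ π) = R.dunkl ρ' y f ∘ₗ π :=
  LinearMap.ext fun x => by simp [dunkl_apply, proj_apply, hπ]

theorem comp_mem_harm {π : V →ₗ[ℂ] V'} (hπ : ∀ g x, π (ρ g x) = ρ' g (π x))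
    {f : V' →ₗ[ℂ] Poly N} (hf : f ∈ R.harm ρ') : f ∘ₗ π ∈ R.harm ρ :=
  ⟨R.comp_mem_logHom hπ hf.1, fun g y => by
    rw [R.hom_comp hπ, R.dunkl_comp hπ, hf.2, LinearMap.zero_comp]⟩

variable (ρ) in
/-- The maps killed by the Dunkl operators that vanish on `D`. -/
def harmVanishing (D : Submodule ℂ V) : Submodule ℂ (V →ₗ[ℂ] Poly N) where
  carrier := {f | f ∈ R.harm ρ ∧ ∀ x ∈ D, f x = 0}
  zero_mem' := ⟨Submodule.zero_mem _, fun _ _ => rfl⟩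
  add_mem' hf hg := ⟨Submodule.add_mem _ hf.1 hg.1,
    fun x hx => by rw [LinearMap.add_apply, hf.2 x hx, hg.2 x hx, add_zero]⟩
  smul_mem' c _ hf := ⟨Submodule.smul_mem _ c hf.1,
    fun x hx => by rw [LinearMap.smul_apply, hf.2 x hx, smul_zero]⟩

theorem hom_mem_harmVanishing {D : Submodule ℂ V} (hD : ∀ g, ∀ x ∈ D, ρ g x ∈ D) (g : G)
    {f : V →ₗ[ℂ] Poly N} (hf : f ∈ R.harmVanishing ρ D) : R.hom ρ g f ∈ R.harmVanishing ρ D :=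
  ⟨R.hom_mem_harm ρ g hf.1, fun x hx => by rw [hom_apply, hf.2 _ (hD _ x hx), map_zero]⟩

theorem mem_of_harmVanishing_apply_eq_zero {D : Submodule ℂ V} (hD : ∀ g, ∀ x ∈ D, ρ g x ∈ D)
    {x : V} (hx : ∀ f ∈ R.harmVanishing ρ D, f x = 0) : x ∈ D := by
  let K : Submodule ℂ V := ⨅ f ∈ R.harmVanishing ρ D, LinearMap.ker f
  have hKmem : ∀ {x}, x ∈ K ↔ ∀ f ∈ R.harmVanishing ρ D, f x = 0 := by
    simp [K, Submodule.mem_iInf]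
  have hK : ∀ g, ∀ x ∈ K, ρ g x ∈ K := fun g x hx => hKmem.2 fun f hf => by
    have h := hKmem.1 hx _ (R.hom_mem_harmVanishing hD g⁻¹ hf)
    rwa [hom_apply, act_eq_zero_iff, inv_inv] at h
  obtain ⟨P, hPK, hP, hPρ⟩ := exists_equivariant_projection ρ hK
  have hDP : ∀ g, ∀ x ∈ D ⊔ LinearMap.ker P, ρ g x ∈ D ⊔ LinearMap.ker P := by
    intro g x hx
    obtain ⟨d, hd, e, he, rfl⟩ := Submodule.mem_sup.1 hx
    rw [map_add]
    refine Submodule.add_mem_sup (hD g d hd) ?_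
    rw [LinearMap.mem_ker, hPρ, LinearMap.mem_ker.1 he, map_zero]
  by_cases htop : D ⊔ LinearMap.ker P = ⊤
  · obtain ⟨d, hd, e, he, hde⟩ := Submodule.mem_sup.1 (htop ▸ Submodule.mem_top : x ∈ _)
    have h1 := hP x (hKmem.2 hx)
    rw [← hde, map_add, LinearMap.mem_ker.1 he, add_zero,
      hP d (hKmem.2 fun f hf => hf.2 d hd)] at h1
    rwa [← hde, ← h1]
  · obtain ⟨k, hk, hle⟩ := R.exists_gradedPart_le_harm hDP htop
    refine absurd ((Submodule.eq_bot_iff _).2 fun f hf => LinearMap.ext fun z => ?_) hk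
    have h1 : f (P z) = 0 := hKmem.1 (hPK z) f
      ⟨hle hf, fun x hx => hf.2.2 x (Submodule.mem_sup_left hx)⟩
    have h2 : f (z - P z) = 0 := hf.2.2 _ (Submodule.mem_sup_right (by
      rw [LinearMap.mem_ker, map_sub, hP _ (hPK z), sub_self]))
    rwa [map_sub, h1, sub_zero] at h2

/-- Evaluation of a vector and at a point, as a functional on a space of maps. -/
def evalFunctional (p : Fin N → ℂ) (Y : Submodule ℂ (V →ₗ[ℂ] Poly N)) :
    V →ₗ[ℂ] Module.Dual ℂ Y :=
  LinearMap.flip ((LinearMap.compRight ℂ (aeval p : Poly N →ₐ[ℂ] ℂ).toLinearMap) ∘ₗ Y.subtype)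

theorem evalFunctional_apply (p : Fin N → ℂ) (Y : Submodule ℂ (V →ₗ[ℂ] Poly N)) (x : V) (f : Y) :
    evalFunctional p Y x f = eval p ((f : V →ₗ[ℂ] Poly N) x) := by
  simp [evalFunctional, aeval_eq_eval]

theorem finrank_le_finrank_harmVanishing_add [FiniteDimensional ℂ V] {D : Submodule ℂ V}
    (hD : ∀ g, ∀ x ∈ D, ρ g x ∈ D) [FiniteDimensional ℂ (R.harmVanishing ρ D)] :
    Module.finrank ℂ V ≤ Module.finrank ℂ (R.harmVanishing ρ D) + Module.finrank ℂ D := by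
  obtain ⟨p, hp⟩ := R.exists_regular
  let Φ := evalFunctional p (R.harmVanishing ρ D)
  have hker : LinearMap.ker Φ ≤ D := by
    intro x hx
    refine R.mem_of_harmVanishing_apply_eq_zero hD fun f hf => ?_
    refine R.apply_eq_zero_of_eval_eq_zero (F := R.harmVanishing ρ D) (fun f hf => hf.1)
      (fun g f hf => R.hom_mem_harmVanishing hD g hf) hp (fun f hf => ?_) hf
    rw [← evalFunctional_apply p (R.harmVanishing ρ D) x ⟨f, hf⟩]
    exact LinearMap.congr_fun (LinearMap.mem_ker.1 hx) _
  rw [← LinearMap.finrank_range_add_finrank_ker Φ]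
  refine add_le_add ?_ (Submodule.finrank_mono hker)
  rw [← Subspace.dual_finrank_eq (K := ℂ) (V := R.harmVanishing ρ D)]
  exact Submodule.finrank_le _

/-- A map on the regular representation is determined by the values of its translates. -/
theorem finrank_harm_regular_le : FiniteDimensional ℂ (R.harm (regular G)) ∧
    Module.finrank ℂ (R.harm (regular G)) ≤ Module.finrank ℂ (G →₀ ℂ) := by
  have := Fintype.ofFinite G
  obtain ⟨p, hp⟩ := R.exists_regular
  let Φ : ((G →₀ ℂ) →ₗ[ℂ] Poly N) →ₗ[ℂ] (G → ℂ) := LinearMap.pi fun g =>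
    (aeval p : Poly N →ₐ[ℂ] ℂ).toLinearMap ∘ₗ
      LinearMap.applyₗ (Finsupp.single 1 1) ∘ₗ R.hom (regular G) g
  have hΦ : ∀ f ∈ R.harm (regular G), Φ f = 0 → f = 0 := by
    intro f hfY hf
    refine Finsupp.lhom_ext' fun g => LinearMap.ext_ring ?_
    have h1 : ∀ g, eval p (R.hom (regular G) g f (Finsupp.single 1 1)) = 0 := fun g => by
      have := congrFun hf g
      simpa [Φ, aeval_eq_eval] using this
    have h2 : R.hom (regular G) g⁻¹ f (Finsupp.single 1 1) = 0 := by
      refine R.apply_eq_zero_of_eval_eq_zero (ρ := regular G)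
        (F := Set.range fun g => R.hom (regular G) g f) ?_ ?_ hp ?_ ⟨g⁻¹, rfl⟩
      · rintro _ ⟨g, rfl⟩
        exact R.hom_mem_harm _ g hfY
      · rintro g' _ ⟨g, rfl⟩
        exact ⟨g' * g, by simp⟩
      · rintro _ ⟨g, rfl⟩
        exact h1 g
    rw [hom_apply, act_eq_zero_iff, inv_inv, regular_single, mul_one] at h2
    simpa using h2
  obtain ⟨h1, h2⟩ := finiteDimensional_and_finrank_le_of_mapsTo
    (M := (G →₀ ℂ) →ₗ[ℂ] Poly N) Φ (Y' := ⊤) (fun _ _ => Submodule.mem_top) hΦ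
  exact ⟨h1, h2.trans (by simp)⟩

/-- The maps killed by Dunkl operators on an irreducible representation form a space of dimension
at most that of the representation. -/
theorem finrank_harm_le [FiniteDimensional ℂ V]
    (hirr : ∀ U : Submodule ℂ V, (∀ g, ∀ x ∈ U, ρ g x ∈ U) → U = ⊥ ∨ U = ⊤) :
    FiniteDimensional ℂ (R.harm ρ) ∧ Module.finrank ℂ (R.harm ρ) ≤ Module.finrank ℂ V := by
  by_cases hV : ∀ x : V, x = 0
  · have h0 : R.harm ρ = ⊥ := (Submodule.eq_bot_iff _).2 fun f _ =>
      LinearMap.ext fun x => by rw [hV x, map_zero, map_zero]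
    rw [h0]
    exact ⟨inferInstance, by simp⟩
  push Not at hV
  obtain ⟨x₀, hx₀⟩ := hV
  let π : (G →₀ ℂ) →ₗ[ℂ] V := Finsupp.linearCombination ℂ fun g => ρ g x₀
  have hπ : ∀ g x, π (regular G g x) = ρ g (π x) := by
    intro g x
    induction x using Finsupp.induction_linear with
    | zero => simp
    | add a b ha hb => simp only [map_add, ha, hb]
    | single h c => simp [π, regular_single]
  have hπtop : LinearMap.range π = ⊤ := by
    refine (hirr _ ?_).resolve_left fun hbot => hx₀ ?_
    · rintro g _ ⟨x, rfl⟩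
      exact ⟨_, hπ g x⟩
    · have h1 : π (Finsupp.single 1 1) = 0 := by
        rw [LinearMap.range_eq_bot.1 hbot, LinearMap.zero_apply]
      simpa [π] using h1
  have hK : ∀ g, ∀ x ∈ LinearMap.ker π, regular G g x ∈ LinearMap.ker π := fun g x hx => by
    rw [LinearMap.mem_ker, hπ, LinearMap.mem_ker.1 hx, map_zero]
  obtain ⟨P, hPK, hP, hPρ⟩ := exists_equivariant_projection (regular G) hK
  have hD : ∀ g, ∀ x ∈ LinearMap.ker P, regular G g x ∈ LinearMap.ker P := fun g x hx => by
    rw [LinearMap.mem_ker, hPρ, LinearMap.mem_ker.1 hx, map_zero]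
  have hle : ∀ D, R.harmVanishing (regular G) D ≤ R.harm (regular G) := fun D f hf => hf.1
  obtain ⟨hfinReg, hleReg⟩ := R.finrank_harm_regular_le
  have hfin : ∀ D, FiniteDimensional ℂ (R.harmVanishing (regular G) D) := fun D =>
    Submodule.finiteDimensional_of_le (hle D)
  have hfin' := hfin (LinearMap.ker π)
  obtain ⟨hfin₀, hle₀⟩ := finiteDimensional_and_finrank_le_of_mapsTo (M := V →ₗ[ℂ] Poly N)
    (M' := (G →₀ ℂ) →ₗ[ℂ] Poly N) (Y := R.harm ρ)
    (Y' := R.harmVanishing (regular G) (LinearMap.ker π)) (LinearMap.lcomp ℂ (Poly N) π)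
    (fun f hf => ⟨R.comp_mem_harm hπ hf, fun x hx => by simp [LinearMap.mem_ker.1 hx]⟩)
    (fun f _ h => LinearMap.ext fun x => by
      obtain ⟨z, rfl⟩ := LinearMap.range_eq_top.1 hπtop x
      exact LinearMap.congr_fun h z)
  refine ⟨hfin₀, hle₀.trans ?_⟩
  have hdisj : R.harmVanishing (regular G) (LinearMap.ker π) ⊓
      R.harmVanishing (regular G) (LinearMap.ker P) = ⊥ := by
    refine (Submodule.eq_bot_iff _).2 fun f hf => LinearMap.ext fun z => ?_
    have h1 : f (P z) = 0 := hf.1.2 _ (hPK z)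
    have h2 : f (z - P z) = 0 := hf.2.2 _ (by
      rw [LinearMap.mem_ker, map_sub, hP _ (hPK z), sub_self])
    rwa [map_sub, h1, sub_zero] at h2
  have h1 := Submodule.finrank_sup_add_finrank_inf_eq
    (R.harmVanishing (regular G) (LinearMap.ker π)) (R.harmVanishing (regular G) (LinearMap.ker P))
  rw [hdisj, finrank_bot, add_zero] at h1
  have h2 := Submodule.finrank_mono (sup_le (hle (LinearMap.ker π)) (hle (LinearMap.ker P)))
  have h4 := R.finrank_le_finrank_harmVanishing_add hD
  have h5 := LinearMap.finrank_range_add_finrank_ker P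
  have h6 : LinearMap.range P ≤ LinearMap.ker π := by
    rintro _ ⟨z, rfl⟩
    exact hPK z
  have h7 := Submodule.finrank_mono h6
  have h8 := LinearMap.finrank_range_add_finrank_ker π
  rw [hπtop, finrank_top] at h8
  have h9 : LinearMap.ker π ≤ LinearMap.range P := fun z hz => ⟨z, hP z hz⟩
  have h10 := Submodule.finrank_mono h9
  omega

end Finite

end ReflectionSystem

namespace ReflectionSystem

variable {N : ℕ} {G A : Type} [Group G] (R : ReflectionSystem N G A)

/-- There is a point of a hyperplane outside of all the other ones. -/
theorem exists_regular_point [Fintype A] (H : A) :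
    ∃ p : Fin N → ℂ, ∑ i, R.root H i * p i = 0 ∧ ∀ H' ≠ H, eval p (R.lin H') ≠ 0 := by
  classical
  by_contra! h
  have hd : R.lin H ∣ ∏ H' ∈ Finset.univ.erase H, R.lin H' := by
    refine linPoly_dvd_of_eval_eq_zero (R.root_ne_zero H) fun p hp => ?_
    obtain ⟨H', hne, h0⟩ := h p hp
    rw [map_prod]
    exact Finset.prod_eq_zero (Finset.mem_erase.2 ⟨hne, Finset.mem_univ _⟩) h0
  obtain ⟨H', hH', hdvd⟩ := ((R.prime_lin H).dvd_finsetProd_iff _).1 hd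
  exact R.not_lin_dvd_lin (Finset.ne_of_mem_erase hH').symm hdvd

section Finite

variable [Finite G] [Fintype A]

section Invariant

variable {V : Type} [AddCommGroup V] [Module ℂ V] {ρ : Representation ℂ G V}

/-- Maps killed by the Dunkl operators whose values at an invariant vector are divisible by a
power of the linear form are divisible by the next power. -/
theorem lin_dvd_of_pow_mul {F : Set (V →ₗ[ℂ] Poly N)} (hF : F ⊆ R.harm ρ)
    (hstable : ∀ g, ∀ f ∈ F, R.hom ρ g f ∈ F) {H : A} {x : V}
    (hx : ∀ h : R.stab H, ρ h x = x) {j : ℕ} (hj : j ≠ 0)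
    (hdvd : ∀ f ∈ F, R.lin H ^ j ∣ f x) {f : V →ₗ[ℂ] Poly N} (hf : f ∈ F) {u : Poly N}
    (hu : f x = R.lin H ^ j * u) : R.lin H ∣ u := by
  classical
  obtain ⟨y, hy⟩ : ∃ y : Fin N → ℂ, ∑ i, R.root H i * y i = 1 := by
    obtain ⟨i, hi⟩ := Function.ne_iff.1 (R.root_ne_zero H)
    exact ⟨Pi.single i (R.root H i)⁻¹, by simpa [Pi.single_apply] using mul_inv_cancel₀ hi⟩
  let Q : Poly N := ∏ H' ∈ Finset.univ.erase H, R.lin H'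
  have hQ : ¬R.lin H ∣ Q := fun hd => by
    obtain ⟨H', hH', hdvd⟩ := ((R.prime_lin H).dvd_finsetProd_iff _).1 hd
    exact R.not_lin_dvd_lin (Finset.ne_of_mem_erase hH').symm hdvd
  let s : ℂ := ∑ h, R.char H h ^ (j + 1)
  have hs : (j : ℂ) - R.mult H * s ≠ 0 := by
    intro h
    rcases R.sum_char_mul_pow_eq_zero_or H (j + 1) with h0 | h0
    · simp only [s, h0, mul_zero, sub_zero, Nat.cast_eq_zero] at h
      exact hj h
    · have hje : j = R.expo H := by
        simp only [s, h0, sub_eq_zero] at h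
        exact_mod_cast h
      have h1 : ∑ h, R.char H h ^ (j + 1) = 0 := by
        rw [← R.sum_char_eq_zero H]
        exact Finset.sum_congr rfl fun h _ => by rw [pow_succ, hje, char_pow_expo, one_mul]
      rw [h1] at h0
      exact (R.natCard_stab_pos H).ne (by exact_mod_cast h0)
  have hprojdvd : ∀ H', R.lin H ^ j ∣ R.proj ρ H' f x := by
    intro H'
    rw [proj, LinearMap.sum_apply, LinearMap.sum_apply]
    refine Finset.dvd_sum fun h _ => ?_
    rw [LinearMap.smul_apply, LinearMap.smul_apply, smul_eq_C_mul]
    exact (hdvd _ (hstable _ f hf)).mul_left _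
  have hproj : R.lin H ^ (j + 1) ∣ R.proj ρ H f x - C s * (R.lin H ^ j * u) := by
    have h1 : R.proj ρ H f x - C s * (R.lin H ^ j * u) =
        R.lin H ^ j * ∑ h : R.stab H, C (R.char H h ^ (j + 1)) * (R.act h u - u) := by
      rw [proj_apply, Finset.mul_sum]
      simp only [s, map_sum, Finset.sum_mul]
      rw [← Finset.sum_sub_distrib]
      refine Finset.sum_congr rfl fun h _ => ?_
      have h2 := hx h⁻¹
      rw [InvMemClass.coe_inv] at h2
      rw [h2, hu, map_mul, map_pow, act_lin, smul_eq_C_mul, mul_pow, pow_succ (R.char H h), C_mul,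
        C_pow]
      ring
    rw [h1, pow_succ]
    exact mul_dvd_mul_left _ (Finset.dvd_sum fun h _ => (R.lin_dvd_act_sub H h u).mul_left _)
  have hmain : Q * R.lin H * dirDeriv y (f x) = (R.mult H : Poly N) * Q * R.proj ρ H f x +
      R.lin H * ∑ H' ∈ Finset.univ.erase H, ((∏ H'' ∈ (Finset.univ.erase H).erase H', R.lin H'') *
        C (∑ i, R.root H' i * y i) * (R.mult H' : Poly N)) * R.proj ρ H' f x := by
    have hH' : ∀ H', (R.mult H' : Poly N) * (R.lin H' * R.divLin H' (R.proj ρ H' f x)) =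
        R.mult H' * R.proj ρ H' f x := fun H' => by
      simpa only [nsmul_eq_mul] using R.mult_smul_lin_mul_divLin ρ (hF hf).1 H' x
    rw [R.dirDeriv_of_mem_harm ρ (hF hf), ← Finset.add_sum_erase _ _ (Finset.mem_univ H), hy,
      mul_add, Finset.mul_sum, Finset.mul_sum, smul_eq_C_mul, mul_one, map_natCast]
    congr 1
    · linear_combination Q * hH' H
    · refine Finset.sum_congr rfl fun H' h => ?_
      rw [smul_eq_C_mul, C_mul, map_natCast]
      simp only [Q]
      rw [← Finset.mul_prod_erase _ _ h]
      linear_combination R.lin H * (∏ H'' ∈ (Finset.univ.erase H).erase H', R.lin H'') *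
        C (∑ i, R.root H' i * y i) * hH' H'
  have hderiv : R.lin H * dirDeriv y (f x) =
      (j : Poly N) * (R.lin H ^ j * u) + R.lin H ^ (j + 1) * dirDeriv y u := by
    have h1 : dirDeriv y (R.lin H) = 1 := by rw [lin, dirDeriv_linPoly, hy, C_1]
    obtain ⟨j, rfl⟩ := Nat.exists_eq_succ_of_ne_zero hj
    rw [hu, Derivation.leibniz, Derivation.leibniz_pow, h1]
    simp only [smul_eq_mul, nsmul_eq_mul, Nat.succ_eq_add_one, add_tsub_cancel_right]
    ring
  have hfin : R.lin H ^ (j + 1) ∣ R.lin H ^ j * (Q * (C ((j : ℂ) - R.mult H * s) * u)) := by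
    obtain ⟨a, ha⟩ := hproj
    choose b hb using hprojdvd
    refine ⟨(R.mult H : Poly N) * Q * a + ∑ H' ∈ Finset.univ.erase H,
      ((∏ H'' ∈ (Finset.univ.erase H).erase H', R.lin H'') *
        C (∑ i, R.root H' i * y i) * (R.mult H' : Poly N)) * b H' - Q * dirDeriv y u, ?_⟩
    have h1 : R.lin H * ∑ H' ∈ Finset.univ.erase H,
        ((∏ H'' ∈ (Finset.univ.erase H).erase H', R.lin H'') *
          C (∑ i, R.root H' i * y i) * (R.mult H' : Poly N)) * R.proj ρ H' f x =
        R.lin H ^ (j + 1) * ∑ H' ∈ Finset.univ.erase H,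
        ((∏ H'' ∈ (Finset.univ.erase H).erase H', R.lin H'') *
          C (∑ i, R.root H' i * y i) * (R.mult H' : Poly N)) * b H' := by
      rw [Finset.mul_sum, Finset.mul_sum]
      refine Finset.sum_congr rfl fun H' _ => ?_
      rw [hb]
      ring
    rw [h1] at hmain
    rw [C_sub, C_mul, map_natCast, map_natCast]
    linear_combination hmain - Q * hderiv + (R.mult H : Poly N) * Q * ha
  rw [pow_succ] at hfin
  have h2 := (mul_dvd_mul_iff_left (pow_ne_zero j (R.lin_ne_zero H))).1 hfin
  refine (((R.prime_lin H).dvd_or_dvd h2).resolve_left hQ).elim fun w hw => ?_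
  refine ⟨C ((j : ℂ) - R.mult H * s)⁻¹ * w, ?_⟩
  rw [mul_left_comm, ← hw, ← mul_assoc, ← C_mul, inv_mul_cancel₀ hs, C_1, one_mul]

/-- A stable family of maps killed by the Dunkl operators is determined on invariants of the
stabilizer of a hyperplane by its values at a generic point of the hyperplane. -/
theorem apply_eq_zero_of_eval_eq_zero_of_invariant {F : Set (V →ₗ[ℂ] Poly N)}
    (hF : F ⊆ R.harm ρ) (hstable : ∀ g, ∀ f ∈ F, R.hom ρ g f ∈ F) {H : A} {p : Fin N → ℂ}
    (hpH : ∑ i, R.root H i * p i = 0) (hp : ∀ H' ≠ H, eval p (R.lin H') ≠ 0) {x : V}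
    (hx : ∀ h : R.stab H, ρ h x = x) (hxp : ∀ f ∈ F, eval p (f x) = 0)
    {f : V →ₗ[ℂ] Poly N} (hf : f ∈ F) : f x = 0 := by
  classical
  have hdvd : ∀ j, ∀ f ∈ F, R.lin H ^ (j + 1) ∣ f x := by
    intro j
    induction j with
    | zero =>
      intro f hf
      rw [zero_add, pow_one]
      refine linPoly_dvd_of_eval_eq_zero (R.root_ne_zero H) fun v hv => ?_
      have := R.eval_add_eq_zero hF hstable (Finset.univ.erase H) (p := p) (y := v - p)
        (fun H' h => hp H' (Finset.ne_of_mem_erase h))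
        (fun H' h => ?_) hxp hf
      · rwa [add_sub_cancel] at this
      · rw [Finset.mem_erase, not_and', Classical.not_not] at h
        rw [h (Finset.mem_univ _)]
        simp [mul_sub, Finset.sum_sub_distrib, hv, hpH]
    | succ j ih =>
      intro f hf
      obtain ⟨u, hu⟩ := ih f hf
      obtain ⟨w, rfl⟩ := R.lin_dvd_of_pow_mul hF hstable hx (Nat.succ_ne_zero j) ih hf hu
      exact ⟨w, by rw [hu]; ring⟩
  by_contra h0
  obtain ⟨k, hk⟩ := FiniteMultiplicity.of_not_isUnit (R.prime_lin H).not_isUnit h0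
  exact hk (hdvd k f hf)

end Invariant

end Finite

end ReflectionSystem

theorem trace_eq_mul_finrank_range {K M : Type} [Field K] [AddCommGroup M] [Module K M]
    [FiniteDimensional K M] {E : M →ₗ[K] M} {c : K} (hc : c ≠ 0)
    (hE : ∀ x, E (E x) = c • E x) :
    LinearMap.trace K M E = c * Module.finrank K (LinearMap.range E) := by
  have hproj : LinearMap.IsProj (LinearMap.range E) (c⁻¹ • E) := by
    refine ⟨fun x => Submodule.smul_mem _ _ ⟨x, rfl⟩, ?_⟩
    rintro _ ⟨x, rfl⟩
    rw [LinearMap.smul_apply, inv_smul_eq_iff₀ hc, hE]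
  rw [← hproj.trace, map_smul, smul_eq_mul, mul_inv_cancel_left₀ hc]

namespace ReflectionSystem

variable {N : ℕ} {G A : Type} [Group G] (R : ReflectionSystem N G A)

/-- The linear forms invariant under the stabilizer of a hyperplane. -/
def invariantForms (H : A) : Submodule ℂ (Fin N → ℂ) where
  carrier := {a | ∀ h : R.stab H, R.coact h a = a}
  zero_mem' h := map_zero _
  add_mem' ha hb h := by rw [map_add, ha h, hb h]
  smul_mem' c _ ha h := by rw [map_smul, ha h]

section Finite

variable [Finite G]

theorem le_finrank_invariantForms_add_one (H : A) :
    N ≤ Module.finrank ℂ (R.invariantForms H) + 1 := by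
  have hn : (Nat.card (R.stab H) : ℂ) ≠ 0 := Nat.cast_ne_zero.2 (R.natCard_stab_pos H).ne'
  have htop : R.invariantForms H ⊔ Submodule.span ℂ {R.root H} = ⊤ := by
    refine eq_top_iff.2 fun a _ => ?_
    choose c hc using fun h : R.stab H => R.coact_sub H h a
    have hinv : ∑ h : R.stab H, R.coact h a ∈ R.invariantForms H := fun g => by
      rw [map_sum]
      refine Fintype.sum_equiv (Equiv.mulLeft g) _ _ fun h => ?_
      simp [← Module.End.mul_apply, ← map_mul]
    have hsum : ∑ h : R.stab H, R.coact h a - (Nat.card (R.stab H) : ℂ) • a =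
        (∑ h, c h) • R.root H := by
      rw [Finset.sum_smul, ← Finset.sum_congr rfl fun h _ => hc h, Finset.sum_sub_distrib]
      simp [Nat.card_eq_fintype_card, Nat.cast_smul_eq_nsmul]
    have ha : a = (Nat.card (R.stab H) : ℂ)⁻¹ • (∑ h : R.stab H, R.coact h a +
        (-∑ h, c h) • R.root H) := by
      rw [neg_smul, ← hsum, eq_inv_smul_iff₀ hn]
      abel
    rw [ha]
    exact Submodule.smul_mem _ _ (Submodule.add_mem_sup hinv
      (Submodule.smul_mem _ _ (Submodule.mem_span_singleton_self _)))
  calc N = Module.finrank ℂ (⊤ : Submodule ℂ (Fin N → ℂ)) := by simp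
    _ ≤ _ := by
      rw [← htop, ← finrank_span_singleton (K := ℂ) (R.root_ne_zero H)]
      exact Submodule.finrank_add_le_finrank_add_finrank _ _

theorem proj_proj {V : Type} [AddCommGroup V] [Module ℂ V] (ρ : Representation ℂ G V) (H : A)
    (f : V →ₗ[ℂ] Poly N) :
    R.proj ρ H (R.proj ρ H f) = (Nat.card (R.stab H) : ℂ) • R.proj ρ H f := by
  have h1 : ∀ g : R.stab H, R.char H g • R.hom ρ g (R.proj ρ H f) = R.proj ρ H f := by
    intro g
    simp only [proj, LinearMap.sum_apply, LinearMap.smul_apply, map_sum, map_smul,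
      Finset.smul_sum, smul_smul]
    refine Fintype.sum_equiv (Equiv.mulLeft g) _ _ fun h => ?_
    simp [← Module.End.mul_apply, ← map_mul]
  have h2 : ∀ f', R.proj ρ H f' = ∑ h : R.stab H, R.char H h • R.hom ρ h f' := fun f' => by
    simp [proj, LinearMap.sum_apply]
  rw [h2 (R.proj ρ H f)]
  simp only [h1]
  simp [Nat.card_eq_fintype_card, Nat.cast_smul_eq_nsmul]

variable [Fintype A]

/-- A homogeneous map killed by the Dunkl operators is an eigenvector of the sum of the
projections. -/
theorem sum_mult_smul_proj {V : Type} [AddCommGroup V] [Module ℂ V] (ρ : Representation ℂ G V)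
    {f : V →ₗ[ℂ] Poly N} (hf : f ∈ R.harm ρ) {k : ℕ} (hk : f ∈ homogHom V N k) :
    ∑ H, (R.mult H : ℂ) • R.proj ρ H f = (k : ℂ) • f := by
  refine LinearMap.ext fun x => ?_
  have h1 := sum_X_mul_dirDeriv_single (hk x)
  simp only [R.dirDeriv_of_mem_harm ρ hf, Finset.mul_sum] at h1
  rw [Finset.sum_comm] at h1
  rw [LinearMap.smul_apply, Nat.cast_smul_eq_nsmul, ← h1, LinearMap.sum_apply]
  refine Finset.sum_congr rfl fun H _ => ?_
  rw [LinearMap.smul_apply, Nat.cast_smul_eq_nsmul, ← R.mult_smul_lin_mul_divLin ρ hf.1 H x,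
    lin, linPoly, Finset.sum_mul, Finset.smul_sum]
  refine Finset.sum_congr rfl fun i _ => ?_
  simp only [Pi.single_apply, mul_ite, mul_one, mul_zero, Finset.sum_ite_eq', Finset.mem_univ,
    if_true, smul_eq_C_mul, C_mul, map_natCast, nsmul_eq_mul]
  ring

/-- The projection attached to a hyperplane has rank at most one on a stable space of maps killed
by the Dunkl operators. -/
theorem finrank_map_proj_le_one {Y : Submodule ℂ ((Fin N → ℂ) →ₗ[ℂ] Poly N)}
    [FiniteDimensional ℂ Y] (hY : Y ≤ R.harm R.coact)
    (hstable : ∀ g, ∀ f ∈ Y, R.hom R.coact g f ∈ Y)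
    (hker : ∀ x, (∀ f ∈ Y, f x = 0) → x = 0) (hrank : Module.finrank ℂ Y ≤ N) {H : A}
    (E : Y →ₗ[ℂ] Y) (hE : ∀ f, (E f : (Fin N → ℂ) →ₗ[ℂ] Poly N) = R.proj R.coact H f) :
    Module.finrank ℂ (LinearMap.range E) ≤ 1 := by
  obtain ⟨p, hpH, hp⟩ := R.exists_regular_point H
  let Ψ : R.invariantForms H →ₗ[ℂ] Module.Dual ℂ Y :=
    evalFunctional p Y ∘ₗ (R.invariantForms H).subtype
  have hΨ : ∀ a f, Ψ a f = eval p ((f : (Fin N → ℂ) →ₗ[ℂ] Poly N) a) := fun a f =>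
    evalFunctional_apply p Y a f
  have hinj : Function.Injective Ψ := by
    refine (injective_iff_map_eq_zero Ψ).2 fun a ha => Subtype.ext (hker a fun f hf => ?_)
    refine R.apply_eq_zero_of_eval_eq_zero_of_invariant (F := Y) hY hstable hpH hp a.2
      (fun f hf => ?_) hf
    rw [← hΨ a ⟨f, hf⟩, ha, LinearMap.zero_apply]
  have hrange : LinearMap.range Ψ ≤ (LinearMap.range E).dualAnnihilator := by
    rintro _ ⟨a, rfl⟩
    rw [Submodule.mem_dualAnnihilator]
    rintro _ ⟨f, rfl⟩
    have hact : ∀ (h : R.stab H) (u : Poly N), eval p (R.act h u) = eval p u := by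
      intro h u
      obtain ⟨w, hw⟩ := R.lin_dvd_act_sub H h u
      rw [← sub_eq_zero, ← map_sub, hw, map_mul, lin, eval_linPoly, hpH, zero_mul]
    have ha : ∀ h : R.stab H, R.coact (h : G)⁻¹ a = a := fun h => a.2 h⁻¹
    rw [hΨ, hE, proj_apply, map_sum]
    simp only [smul_eval, hact, ha]
    rw [← Finset.sum_mul, sum_char_eq_zero, zero_mul]
  have h1 := LinearMap.finrank_range_of_inj hinj
  have h2 := Submodule.finrank_mono hrange
  have h3 := Subspace.finrank_add_finrank_dualAnnihilator_eq (LinearMap.range E)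
  have h4 := R.le_finrank_invariantForms_add_one H
  omega

/-- The degree bound obtained by taking traces in Euler's relation. -/
theorem finrank_mul_le_sum_expo {Y : Submodule ℂ ((Fin N → ℂ) →ₗ[ℂ] Poly N)}
    [FiniteDimensional ℂ Y] (hY : Y ≤ R.harm R.coact)
    (hstable : ∀ g, ∀ f ∈ Y, R.hom R.coact g f ∈ Y)
    (hker : ∀ x, (∀ f ∈ Y, f x = 0) → x = 0) (hrank : Module.finrank ℂ Y ≤ N) {k : ℕ}
    (hk : Y ≤ homogHom (Fin N → ℂ) N k) :
    Module.finrank ℂ Y * k ≤ ∑ H, R.expo H := by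
  let E : A → Y →ₗ[ℂ] Y := fun H =>
    (R.proj R.coact H).restrict fun f hf => R.proj_mem R.coact fun g => hstable g f hf
  have hE : ∀ H f, (E H f : (Fin N → ℂ) →ₗ[ℂ] Poly N) = R.proj R.coact H f := fun _ _ => rfl
  have htr : ∀ H, LinearMap.trace ℂ Y (E H) =
      (Nat.card (R.stab H) : ℂ) * Module.finrank ℂ (LinearMap.range (E H)) := by
    intro H
    exact trace_eq_mul_finrank_range (Nat.cast_ne_zero.2 (R.natCard_stab_pos H).ne')
      fun f => Subtype.ext (R.proj_proj R.coact H f)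
  have hsum : ∑ H, (R.mult H : ℂ) • E H = (k : ℂ) • LinearMap.id := by
    refine LinearMap.ext fun f => Subtype.ext ?_
    have := R.sum_mult_smul_proj R.coact (hY f.2) (hk f.2)
    simpa [LinearMap.sum_apply, hE] using this
  have htrace : (Module.finrank ℂ Y * k : ℕ) =
      ∑ H, R.expo H * Module.finrank ℂ (LinearMap.range (E H)) := by
    have h := congrArg (LinearMap.trace ℂ Y) hsum
    simp only [map_sum, map_smul, htr, LinearMap.trace_id, smul_eq_mul, ← mul_assoc] at h
    rw [mul_comm]
    simp only [expo]
    exact_mod_cast h.symm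
  rw [htrace]
  refine Finset.sum_le_sum fun H _ => ?_
  exact mul_le_of_le_one_right (Nat.zero_le _)
    (R.finrank_map_proj_le_one hY hstable hker hrank (E H) (hE H))

end Finite

end ReflectionSystem

theorem isHomogeneous_det {N k : ℕ} {M : Matrix (Fin N) (Fin N) (Poly N)}
    (hM : ∀ i j, (M i j).IsHomogeneous k) : M.det.IsHomogeneous (N * k) := by
  rw [Matrix.det_apply']
  refine IsHomogeneous.sum _ _ _ fun σ _ => ?_
  have h := (isHomogeneous_C (Fin N) ((Equiv.Perm.sign σ : ℤ) : ℂ)).mul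
    (IsHomogeneous.prod Finset.univ (fun i => M (σ i) i) (fun _ => k) fun i _ => hM _ _)
  simpa using h

theorem apply_eq_sum_smul {N : ℕ} (f : (Fin N → ℂ) →ₗ[ℂ] Poly N) (a : Fin N → ℂ) :
    f a = ∑ i, C (a i) * f (Pi.single i 1) := by
  conv_lhs => rw [← Finset.univ_sum_single a, map_sum]
  refine Finset.sum_congr rfl fun i _ => ?_
  rw [← smul_eq_C_mul, ← map_smul, ← Pi.single_smul, smul_eq_mul, mul_one]

/-- The matrix of coefficients of a family of polynomial vector fields. -/
def coeffMatrix {N : ℕ} (L : Fin N → (Fin N → ℂ) →ₗ[ℂ] Poly N) :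
    Matrix (Fin N) (Fin N) (Poly N) :=
  Matrix.of fun k i => L k (Pi.single i 1)

theorem coeffMatrix_apply {N : ℕ} (L : Fin N → (Fin N → ℂ) →ₗ[ℂ] Poly N) (k i : Fin N) :
    coeffMatrix L k i = L k (Pi.single i 1) := rfl

namespace ReflectionSystem

variable {N : ℕ} {G A : Type} [Group G] (R : ReflectionSystem N G A)

theorem pow_expo_dvd_det {L : Fin N → (Fin N → ℂ) →ₗ[ℂ] Poly N}
    (hL : ∀ k, L k ∈ R.logHom R.coact) (H : A) :
    R.lin H ^ R.expo H ∣ (coeffMatrix L).det := by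
  obtain ⟨j, hj⟩ := Function.ne_iff.1 (R.root_ne_zero H)
  choose u hu using fun k => hL k H (R.root H) (R.coact_root H)
  have h := Matrix.det_updateCol_sum (coeffMatrix L) j fun i => C (R.root H i)
  have hcol : (fun k => ∑ i, (C (R.root H i) : Poly N) • coeffMatrix L k i) =
      R.lin H ^ R.expo H • u := by
    funext k
    rw [Pi.smul_apply, smul_eq_mul, ← hu, apply_eq_sum_smul]
    rfl
  rw [hcol, Matrix.det_updateCol_smul] at h
  refine ⟨C (R.root H j)⁻¹ * ((coeffMatrix L).updateCol j u).det, ?_⟩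
  rw [mul_left_comm, h, smul_eq_mul, ← mul_assoc, ← C_mul, inv_mul_cancel₀ hj, C_1, one_mul]

/-- The divisibility property for the dual reflection representation only involves the linear
forms of the hyperplanes. -/
theorem mem_logHom_coact {f : (Fin N → ℂ) →ₗ[ℂ] Poly N} :
    f ∈ R.logHom R.coact ↔ ∀ H, R.lin H ^ R.expo H ∣ f (R.root H) := by
  refine ⟨fun hf H => hf H _ (R.coact_root H), fun hf H a ha => ?_⟩
  obtain ⟨h, hh⟩ := R.exists_char_ne_one H
  obtain ⟨c, hc⟩ := R.coact_sub H h a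
  have h1 : (R.char H h - 1) • a = c • R.root H := by rw [sub_smul, one_smul, ← ha h, hc]
  rw [← inv_smul_smul₀ (sub_ne_zero.2 hh) a, h1, smul_smul, map_smul, smul_eq_C_mul]
  exact (hf H).mul_left _

variable [Fintype A]

/-- The product of the powers of the linear forms. -/
def definingPoly : Poly N := ∏ H, R.lin H ^ R.expo H

theorem definingPoly_ne_zero : R.definingPoly ≠ 0 :=
  Finset.prod_ne_zero_iff.2 fun H _ => pow_ne_zero _ (R.lin_ne_zero H)

theorem totalDegree_definingPoly : R.definingPoly.totalDegree = ∑ H, R.expo H := by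
  refine IsHomogeneous.totalDegree (IsHomogeneous.prod _ _ _ fun H _ => ?_)
    R.definingPoly_ne_zero
  simpa [lin] using (isHomogeneous_linPoly (R.root H)).pow (R.expo H)

theorem definingPoly_dvd_det {L : Fin N → (Fin N → ℂ) →ₗ[ℂ] Poly N}
    (hL : ∀ k, L k ∈ R.logHom R.coact) : R.definingPoly ∣ (coeffMatrix L).det :=
  Finset.prod_dvd_of_isRelPrime
    (fun H _ _ _ hne => IsRelPrime.pow
      ((R.prime_lin H).irreducible.isRelPrime_iff_not_dvd.2 (R.not_lin_dvd_lin hne)))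
    fun H _ => R.pow_expo_dvd_det hL H

/-- Saito's criterion. -/
theorem exists_eq_sum_of_det_eq {L : Fin N → (Fin N → ℂ) →ₗ[ℂ] Poly N}
    (hL : ∀ k, L k ∈ R.logHom R.coact) {c : ℂ} (hc : c ≠ 0)
    (hdet : (coeffMatrix L).det = C c * R.definingPoly) {f : (Fin N → ℂ) →ₗ[ℂ] Poly N}
    (hf : f ∈ R.logHom R.coact) :
    ∃ w : Fin N → Poly N, ∀ i, f (Pi.single i 1) = ∑ k, w k * L k (Pi.single i 1) := by
  have hw : ∀ k, R.definingPoly ∣ ((coeffMatrix L).updateRow k fun i => f (Pi.single i 1)).det := by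
    intro k
    have hLk : ∀ k', Function.update L k f k' ∈ R.logHom R.coact := by
      intro k'
      rcases eq_or_ne k' k with rfl | hne
      · rwa [Function.update_self]
      · rw [Function.update_of_ne hne]
        exact hL k'
    have h := R.definingPoly_dvd_det hLk
    have he : coeffMatrix (Function.update L k f) =
        (coeffMatrix L).updateRow k fun i => f (Pi.single i 1) := by
      refine Matrix.ext fun k' i => ?_
      rcases eq_or_ne k' k with rfl | hne
      · simp [coeffMatrix]
      · simp [coeffMatrix, hne]
    rwa [he] at h
  choose w hw using hw
  refine ⟨fun k => C c⁻¹ * w k, fun i => mul_left_cancel₀ R.definingPoly_ne_zero ?_⟩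
  have h := congrFun (Matrix.mulVec_cramer (coeffMatrix L).transpose
    fun i => f (Pi.single i 1)) i
  simp only [Matrix.mulVec, dotProduct, Matrix.transpose_apply, Matrix.cramer_transpose_apply, hw,
    Matrix.det_transpose, hdet, Pi.smul_apply, smul_eq_mul, coeffMatrix_apply] at h
  have hcc : C c * C c⁻¹ = (1 : Poly N) := by rw [← C_mul, mul_inv_cancel₀ hc, C_1]
  refine mul_left_cancel₀ (C_ne_zero.2 hc : (C c : Poly N) ≠ 0) ?_
  rw [← mul_assoc, ← h, Finset.mul_sum, Finset.mul_sum]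
  refine Finset.sum_congr rfl fun k _ => ?_
  linear_combination -(L k (Pi.single i 1) * R.definingPoly * w k) * hcc

variable [Finite G]

/-- There is a stable space of homogeneous maps killed by the Dunkl operators whose dimension is
the rank. -/
theorem exists_stable_subspace (hN : 0 < N) (hirr : ∀ U : Submodule ℂ (Fin N → ℂ),
      (∀ g, ∀ a ∈ U, R.coact g a ∈ U) → U = ⊥ ∨ U = ⊤) :
    ∃ (k : ℕ) (Y : Submodule ℂ ((Fin N → ℂ) →ₗ[ℂ] Poly N)), Y ≤ R.harm R.coact ∧
      (∀ g, ∀ f ∈ Y, R.hom R.coact g f ∈ Y) ∧ (∀ x, (∀ f ∈ Y, f x = 0) → x = 0) ∧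
      Y ≤ homogHom (Fin N → ℂ) N k ∧ FiniteDimensional ℂ Y ∧ Module.finrank ℂ Y = N := by
  have hD : ∀ g, ∀ x ∈ (⊥ : Submodule ℂ (Fin N → ℂ)), R.coact g x ∈ (⊥ : Submodule ℂ _) :=
    fun g x hx => by rw [(Submodule.mem_bot ℂ).1 hx, map_zero]; exact Submodule.zero_mem _
  have : Nonempty (Fin N) := ⟨⟨0, hN⟩⟩
  obtain ⟨k, hk, hle⟩ := R.exists_gradedPart_le_harm hD bot_ne_top
  have hstable : ∀ g, ∀ f ∈ R.gradedPart R.coact ⊥ k,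
      R.hom R.coact g f ∈ R.gradedPart R.coact ⊥ k := fun g f hf => R.hom_mem_gradedPart hD g hf
  obtain ⟨hfin, hrank⟩ := R.finrank_harm_le (ρ := R.coact) hirr
  have hfinY : FiniteDimensional ℂ (R.gradedPart R.coact ⊥ k) :=
    Submodule.finiteDimensional_of_le hle
  have hker : ∀ x, (∀ f ∈ R.gradedPart R.coact ⊥ k, f x = 0) → x = 0 := by
    let K : Submodule ℂ (Fin N → ℂ) := ⨅ f ∈ R.gradedPart R.coact ⊥ k, LinearMap.ker f
    have hKmem : ∀ {x}, x ∈ K ↔ ∀ f ∈ R.gradedPart R.coact ⊥ k, f x = 0 := by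
      simp [K, Submodule.mem_iInf]
    have hK : K = ⊥ := by
      refine (hirr K fun g x hx => hKmem.2 fun f hf => ?_).resolve_right fun htop => hk ?_
      · have h := hKmem.1 hx _ (hstable g⁻¹ f hf)
        rwa [hom_apply, act_eq_zero_iff, inv_inv] at h
      · exact (Submodule.eq_bot_iff _).2 fun f hf => LinearMap.ext fun x =>
          hKmem.1 (htop ▸ Submodule.mem_top : x ∈ K) f hf
    intro x hx
    rw [← Submodule.mem_bot ℂ, ← hK]
    exact hKmem.2 hx
  refine ⟨k, _, hle, hstable, hker, fun f hf => hf.2.1, hfinY, le_antisymm ?_ ?_⟩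
  · exact (Submodule.finrank_mono hle).trans (hrank.trans (by simp))
  · obtain ⟨p, hp⟩ := R.exists_regular
    have hinj : Function.Injective (evalFunctional p (R.gradedPart R.coact ⊥ k)) := by
      refine (injective_iff_map_eq_zero _).2 fun x hx => hker x fun f hf => ?_
      refine R.apply_eq_zero_of_eval_eq_zero (F := R.gradedPart R.coact ⊥ k) hle hstable hp
        (fun f hf => ?_) hf
      rw [← evalFunctional_apply p _ x ⟨f, hf⟩, hx, LinearMap.zero_apply]
    calc N = Module.finrank ℂ (Fin N → ℂ) := by simp
      _ ≤ Module.finrank ℂ (Module.Dual ℂ (R.gradedPart R.coact ⊥ k)) :=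
        LinearMap.finrank_le_finrank_of_injective hinj
      _ = _ := Subspace.dual_finrank_eq

theorem exists_basis (hN : 0 < N) (hirr : ∀ U : Submodule ℂ (Fin N → ℂ),
      (∀ g, ∀ a ∈ U, R.coact g a ∈ U) → U = ⊥ ∨ U = ⊤) :
    ∃ (L : Fin N → (Fin N → ℂ) →ₗ[ℂ] Poly N) (d : ℕ), N * d = ∑ H, R.expo H ∧
      (∀ k, L k ∈ R.logHom R.coact) ∧ (∀ k, L k ∈ homogHom (Fin N → ℂ) N d) ∧
      (∀ f ∈ R.logHom R.coact, ∃ c : Fin N → Poly N,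
        ∀ i, f (Pi.single i 1) = ∑ k, c k * L k (Pi.single i 1)) ∧
      ∀ c : Fin N → Poly N, (∀ i, ∑ k, c k * L k (Pi.single i 1) = 0) → ∀ k, c k = 0 := by
  obtain ⟨d, Y, hY, hstable, hker, hhom, hfin, hrank⟩ := R.exists_stable_subspace hN hirr
  let b := Module.finBasisOfFinrankEq ℂ Y hrank
  let L : Fin N → (Fin N → ℂ) →ₗ[ℂ] Poly N := fun k => b k
  have hLog : ∀ k, L k ∈ R.logHom R.coact := fun k => (hY (b k).2).1
  have hdet : (coeffMatrix L).det ≠ 0 := by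
    intro h0
    obtain ⟨p, hp⟩ := R.exists_regular
    have h1 : ((eval p).mapMatrix (coeffMatrix L)).det = 0 := by
      rw [← RingHom.map_det, h0, map_zero]
    obtain ⟨v, hv, hv0⟩ := Matrix.exists_mulVec_eq_zero_iff.2 h1
    refine hv (hker v fun f hf => ?_)
    refine R.apply_eq_zero_of_eval_eq_zero (F := Y) hY hstable hp (fun f hf => ?_) hf
    have h2 : evalFunctional p Y v = 0 := by
      refine b.ext fun k => ?_
      rw [evalFunctional_apply, apply_eq_sum_smul, map_sum, LinearMap.zero_apply]
      have h3 := congrFun hv0 k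
      simp only [Matrix.mulVec, dotProduct, RingHom.mapMatrix_apply, Matrix.map_apply,
        coeffMatrix_apply, Pi.zero_apply] at h3
      rw [← h3]
      refine Finset.sum_congr rfl fun i _ => ?_
      rw [map_mul, eval_C, mul_comm]
    rw [← evalFunctional_apply p Y v ⟨f, hf⟩, h2, LinearMap.zero_apply]
  have hdeg : (coeffMatrix L).det.totalDegree = N * d :=
    (isHomogeneous_det fun k i => hhom (b k).2 _).totalDegree hdet
  have hbound : N * d ≤ ∑ H, R.expo H := by
    simpa only [hrank] using R.finrank_mul_le_sum_expo hY hstable hker hrank.le hhom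
  obtain ⟨q, hq⟩ := R.definingPoly_dvd_det hLog
  have hq0 : q ≠ 0 := fun h => hdet (by rw [hq, h, mul_zero])
  have hsum : N * d = ∑ H, R.expo H + q.totalDegree := by
    rw [← hdeg, hq, totalDegree_mul_of_isDomain R.definingPoly_ne_zero hq0,
      totalDegree_definingPoly]
  have hqC : q = C (coeff 0 q) := totalDegree_eq_zero_iff_eq_C.1 (by omega)
  refine ⟨L, d, by omega, hLog, fun k => hhom (b k).2, fun f hf => ?_, fun c hc k => ?_⟩
  · refine R.exists_eq_sum_of_det_eq hLog (c := coeff 0 q) (fun h => hq0 ?_) ?_ hf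
    · rw [hqC, h, C_0]
    · rw [hq, mul_comm, ← hqC]
  · exact congrFun (Matrix.eq_zero_of_vecMul_eq_zero hdet (v := c) (funext hc)) k

end ReflectionSystem

section LinearGroup

variable {N : ℕ} (W : Subgroup (Matrix.GeneralLinearGroup (Fin N) ℂ))

/-- The action of a linear group on column vectors. -/
def vectorRep : Representation ℂ W (Fin N → ℂ) where
  toFun g := Matrix.mulVecLin (g : Matrix.GeneralLinearGroup (Fin N) ℂ).1
  map_one' := by ext; simp
  map_mul' g h := LinearMap.ext fun v => by simp

/-- The dual action of a linear group on linear forms. -/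
def formRep : Representation ℂ W (Fin N → ℂ) where
  toFun g := Matrix.vecMulLinear (g⁻¹ : Matrix.GeneralLinearGroup (Fin N) ℂ).1
  map_one' := LinearMap.ext fun a => by simp
  map_mul' g h := LinearMap.ext fun a => by simp [Matrix.vecMul_vecMul]

variable {W}

theorem formRep_dotProduct (g : W) (a v : Fin N → ℂ) :
    formRep W g a ⬝ᵥ v = a ⬝ᵥ vectorRep W g⁻¹ v :=
  (Matrix.dotProduct_mulVec _ _ _).symm

theorem vectorRep_mul_apply (g h : W) (v : Fin N → ℂ) :
    vectorRep W (g * h) v = vectorRep W g (vectorRep W h v) := by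
  rw [map_mul, Module.End.mul_apply]

theorem vectorRep_inv_apply (g : W) (v : Fin N → ℂ) :
    vectorRep W g (vectorRep W g⁻¹ v) = v := by
  rw [← vectorRep_mul_apply, mul_inv_cancel, map_one, Module.End.one_apply]

theorem vectorRep_apply_inv (g : W) (v : Fin N → ℂ) :
    vectorRep W g⁻¹ (vectorRep W g v) = v := by
  rw [← vectorRep_mul_apply, inv_mul_cancel, map_one, Module.End.one_apply]

/-- The dual of an irreducible linear group is irreducible. -/
theorem formRep_irreducible (hirr : ∀ U : Submodule ℂ (Fin N → ℂ),
      (∀ g, ∀ v ∈ U, vectorRep W g v ∈ U) → U = ⊥ ∨ U = ⊤) (U : Submodule ℂ (Fin N → ℂ))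
    (hU : ∀ g, ∀ a ∈ U, formRep W g a ∈ U) : U = ⊥ ∨ U = ⊤ := by
  let P : Submodule ℂ (Fin N → ℂ) :=
    { carrier := {v | ∀ a ∈ U, a ⬝ᵥ v = 0}
      zero_mem' := fun a _ => dotProduct_zero a
      add_mem' := fun hv hw a ha => by rw [dotProduct_add, hv a ha, hw a ha, add_zero]
      smul_mem' := fun c v hv a ha => by rw [dotProduct_smul, hv a ha, smul_zero] }
  have hP : ∀ g, ∀ v ∈ P, vectorRep W g v ∈ P := fun g v hv a ha => by
    have h := hv _ (hU g⁻¹ a ha)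
    rwa [formRep_dotProduct, inv_inv] at h
  rcases hirr P hP with h | h
  · right
    by_contra hne
    obtain ⟨φ, hφ, hle⟩ := Submodule.exists_le_ker_of_lt_top U (lt_top_iff_ne_top.2 hne)
    have happ : ∀ a, φ a = a ⬝ᵥ fun i => φ (Pi.single i 1) := fun a => by
      conv_lhs => rw [← Finset.univ_sum_single a, map_sum]
      refine Finset.sum_congr rfl fun i _ => ?_
      rw [← smul_eq_mul, ← map_smul, ← Pi.single_smul, smul_eq_mul, mul_one]
    have hmem : (fun i => φ (Pi.single i 1)) ∈ P := fun a ha => by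
      rw [← happ]
      exact hle ha
    rw [h, Submodule.mem_bot] at hmem
    exact hφ (LinearMap.ext fun a => by rw [happ, hmem, dotProduct_zero, LinearMap.zero_apply])
  · left
    refine (Submodule.eq_bot_iff _).2 fun a ha => funext fun i => ?_
    have hi : Pi.single i 1 ∈ P := h ▸ Submodule.mem_top
    simpa using hi a ha

variable (W) in
/-- The pointwise stabilizer of the hyperplane with linear form `a`. -/
def fixer (a : Fin N → ℂ) : Subgroup W where
  carrier := {g | ∀ v, a ⬝ᵥ v = 0 → vectorRep W g v = v}
  one_mem' v _ := by rw [map_one, Module.End.one_apply]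
  mul_mem' hg hh v hv := by rw [vectorRep_mul_apply, hh v hv, hg v hv]
  inv_mem' {g} hg v hv := by
    conv_lhs => rw [← hg v hv]
    exact vectorRep_apply_inv g v

theorem mem_fixer {a : Fin N → ℂ} {g : W} :
    g ∈ fixer W a ↔ ∀ v, a ⬝ᵥ v = 0 → vectorRep W g v = v := Iff.rfl

theorem mem_fixer_smul_formRep {a : Fin N → ℂ} {c : ℂ} (hc : c ≠ 0) (g : W) {h : W} :
    h ∈ fixer W (c • formRep W g a) ↔ g⁻¹ * h * g ∈ fixer W a := by
  have hiff : ∀ v, (c • formRep W g a) ⬝ᵥ v = 0 ↔ a ⬝ᵥ vectorRep W g⁻¹ v = 0 := fun v => by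
    rw [smul_dotProduct, formRep_dotProduct, smul_eq_zero_iff_right hc]
  refine ⟨fun hh v hv => ?_, fun hh v hv => ?_⟩
  · rw [vectorRep_mul_apply, vectorRep_mul_apply, hh _ ((hiff _).2 ?_), vectorRep_apply_inv]
    rwa [vectorRep_apply_inv]
  · have h1 := hh _ ((hiff v).1 hv)
    rw [vectorRep_mul_apply, vectorRep_mul_apply, vectorRep_inv_apply] at h1
    rw [← vectorRep_inv_apply g (vectorRep W h v), h1, vectorRep_inv_apply]

theorem card_fixer_smul_formRep {a : Fin N → ℂ} {c : ℂ} (hc : c ≠ 0) (g : W) :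
    Nat.card (fixer W (c • formRep W g a)) = Nat.card (fixer W a) :=
  Nat.card_congr ((MulAut.conj g⁻¹).toEquiv.subtypeEquiv fun h => by
    rw [mem_fixer_smul_formRep hc]
    simp)

theorem formRep_sub_eq_smul {a : Fin N → ℂ} (ha : a ≠ 0) {h : W} (hh : h ∈ fixer W a)
    (b : Fin N → ℂ) : ∃ c : ℂ, formRep W h b - b = c • a := by
  rcases eq_or_ne (formRep W h b - b) 0 with h0 | h0
  · exact ⟨0, by rw [h0, zero_smul]⟩
  · refine exists_eq_smul_of_linPoly_dvd ha h0 (linPoly_dvd_of_eval_eq_zero ha fun v hv => ?_)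
    rw [eval_linPoly]
    change (formRep W h b - b) ⬝ᵥ v = 0
    rw [sub_dotProduct, formRep_dotProduct, (mem_fixer.1 (inv_mem hh)) v hv, sub_self]

theorem exists_formRep_eq_smul {a : Fin N → ℂ} (ha : a ≠ 0) {h : W} (hh : h ∈ fixer W a) :
    ∃ c : ℂ, formRep W h a = c • a := by
  obtain ⟨c, hc⟩ := formRep_sub_eq_smul ha hh a
  exact ⟨c + 1, by rw [add_smul, one_smul, ← hc, sub_add_cancel]⟩

/-- An element of a finite group fixing a hyperplane and its linear form is trivial. -/
theorem eq_one_of_formRep_eq [Finite W] {a : Fin N → ℂ} (ha : a ≠ 0) {h : W}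
    (hh : h ∈ fixer W a) (hfix : formRep W h a = a) : h = 1 := by
  have hall : ∀ b, formRep W h b = b := by
    intro b
    obtain ⟨c, hc⟩ := formRep_sub_eq_smul ha hh b
    have hpow : ∀ k : ℕ, formRep W (h ^ k) b = b + ((k : ℂ) * c) • a := by
      intro k
      induction k with
      | zero => simp
      | succ k ih =>
        rw [pow_succ', map_mul, Module.End.mul_apply, ih, map_add, map_smul, hfix,
          ← sub_add_cancel (formRep W h b) b, hc]
        push_cast
        module
    have h1 := hpow (orderOf h)
    rw [pow_orderOf_eq_one, map_one, Module.End.one_apply, left_eq_add, smul_eq_zero,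
      mul_eq_zero, Nat.cast_eq_zero] at h1
    have h2 : c = 0 := (h1.resolve_right ha).resolve_left (orderOf_pos h).ne'
    rw [← sub_eq_zero, hc, h2, zero_smul]
  have h1 : ((h : Matrix.GeneralLinearGroup (Fin N) ℂ)⁻¹).1 = 1 := by
    refine Matrix.ext_of_single_vecMul fun i => ?_
    rw [Matrix.vecMul_one]
    exact hall _
  exact Subtype.ext (inv_eq_one.1 (Units.ext h1))

theorem exists_reflectionSystem [Finite W] {A : Type} {α : A → Fin N → ℂ} (hα : ∀ H, α H ≠ 0)
    (hdistinct : ∀ H H', (∃ c : ℂ, α H' = c • α H) → H = H')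
    (hrefl : ∀ H, ∃ g ∈ fixer W (α H), g ≠ 1) (m : A → ℕ)
    (hm : ∀ (g : W) (H : A), ∃ H', (∃ c : ℂ, c ≠ 0 ∧ α H' = c • formRep W g (α H)) ∧
      m H' = m H) :
    ∃ R : ReflectionSystem N W A, R.coact = formRep W ∧ R.root = α ∧
      ∀ H, R.expo H = m H * Nat.card (fixer W (α H)) := by
  choose χ hχ using fun H (h : fixer W (α H)) => exists_formRep_eq_smul (hα H) h.2
  refine ⟨{
    coact := formRep W
    root := α
    root_ne_zero := hα
    eq_of_root_eq_smul := hdistinct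
    stab := fun H => fixer W (α H)
    char := fun H =>
      { toFun := χ H
        map_one' := smul_left_injective ℂ (hα H) ?_
        map_mul' := fun g h => smul_left_injective ℂ (hα H) ?_ }
    coact_root := hχ
    coact_sub := fun H h b => formRep_sub_eq_smul (hα H) h.2 b
    exists_char_ne_one := fun H => ?_
    mult := m
    conj := fun g H => ?_ }, rfl, rfl, fun H => rfl⟩
  · simp [← hχ]
  · change χ H (g * h) • α H = (χ H g * χ H h) • α H
    rw [← hχ, Subgroup.coe_mul, map_mul, Module.End.mul_apply, hχ H h, map_smul, hχ H g, smul_smul,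
      mul_comm]
  · obtain ⟨g, hg, hne⟩ := hrefl H
    refine ⟨⟨g, hg⟩, fun h1 => hne (eq_one_of_formRep_eq (hα H) hg ?_)⟩
    exact (hχ H ⟨g, hg⟩).trans (by rw [show χ H ⟨g, hg⟩ = 1 from h1, one_smul])
  · obtain ⟨H', ⟨c, hc, hroot⟩, hmult⟩ := hm g H
    refine ⟨H', ⟨c, hroot⟩, ?_, ?_⟩
    · rw [hmult, hroot, card_fixer_smul_formRep hc]
    · rintro ⟨h', hh'⟩
      rw [hroot, mem_fixer_smul_formRep hc] at hh'
      exact ⟨⟨_, hh'⟩, rfl⟩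

end LinearGroup

theorem applyVF_linPoly {N : ℕ} (f : Fin N → MvPolynomial (Fin N) ℂ) (a : Fin N → ℂ) :
    applyVF f (linPoly a) = Fintype.linearCombination ℂ f a := by
  simp only [applyVF, linPoly, Fintype.linearCombination_apply, smul_eq_C_mul]
  refine Finset.sum_congr rfl fun i _ => ?_
  simp [pderiv_X, Pi.single_apply, mul_comm]

end ReflectionArrangement

/-- the `S`-module `D̃_m` is free, with a free basis of `N` homogeneous
vector fields `L^{(k)} = Σ f_i^{(k)} ∂_i` in which every nonzero component `f_i^{(k)}` is
homogeneous of the same degree `(1/N)·Σ_{H ∈ 𝒜} m_H n_H` (in particular this is a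
nonnegative integer `d` with `N·d = Σ_H m_H n_H`). -/
theorem stmt_8 (N : ℕ) (hN : 0 < N)
    -- `W` is an irreducible finite complex reflection group
    (W : Subgroup (Matrix.GeneralLinearGroup (Fin N) ℂ)) (hWfin : Finite W)
    (hgen : Subgroup.closure {g | g ∈ W ∧ IsReflection g} = W)
    (hirr : ∀ U : Submodule ℂ (Fin N → ℂ),
      (∀ g ∈ W, ∀ v ∈ U, (↑g : Matrix (Fin N) (Fin N) ℂ).mulVec v ∈ U) → U = ⊥ ∨ U = ⊤)
    -- `𝒜` is the (finite) set of reflection hyperplanes of `W`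
    (A : Type) (hAfin : Fintype A)
    (α : A → (Fin N → ℂ)) (hα : ∀ H, α H ≠ 0)
    (hdistinct : ∀ H H', (∃ c : ℂ, α H' = c • α H) → H = H')
    (hcomplete : ∀ g ∈ W, IsReflection g → ∃ H, ∀ v : Fin N → ℂ,
      ((↑g : Matrix (Fin N) (Fin N) ℂ).mulVec v = v ↔ ∑ i, α H i * v i = 0))
    (hrefl : ∀ H, ∃ g ∈ W, IsReflection g ∧ ∀ v : Fin N → ℂ,
      (∑ i, α H i * v i) = 0 → (↑g : Matrix (Fin N) (Fin N) ℂ).mulVec v = v)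
    -- `n_H` is the order of the pointwise stabilizer `W_H`
    (n : A → ℕ)
    (hnstab : ∀ H, n H = Nat.card {g : W | ∀ v : Fin N → ℂ,
      (∑ i, α H i * v i) = 0 →
        (↑(g : Matrix.GeneralLinearGroup (Fin N) ℂ) : Matrix (Fin N) (Fin N) ℂ).mulVec v = v})
    -- `m` is a `W`-invariant multiplicity function
    (m : A → ℕ)
    (hminv : ∀ g ∈ W, ∀ H, ∃ H', (∃ c : ℂ, c ≠ 0 ∧
        α H' = c • Matrix.vecMul (α H) (↑(g⁻¹) : Matrix (Fin N) (Fin N) ℂ)) ∧ m H' = m H) :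
    ∃ (L : Fin N → (Fin N → MvPolynomial (Fin N) ℂ)) (d : ℕ),
      -- `d = (1/N)·Σ_H m_H n_H`
      N * d = (∑ H : A, m H * n H) ∧
      -- each `L^{(k)}` belongs to `D̃_m`
      (∀ k H, linPoly (α H) ^ (m H * n H) ∣ applyVF (L k) (linPoly (α H))) ∧
      -- every nonzero component is homogeneous of degree `d`
      (∀ k i, L k i = 0 ∨ (L k i).IsHomogeneous d) ∧
      -- the `L^{(k)}` generate `D̃_m` over `S`
      (∀ f : Fin N → MvPolynomial (Fin N) ℂ,
        (∀ H, linPoly (α H) ^ (m H * n H) ∣ applyVF f (linPoly (α H))) →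
        ∃ c : Fin N → MvPolynomial (Fin N) ℂ, ∀ i, f i = ∑ k, c k * L k i) ∧
      -- and they are independent over `S`
      (∀ c : Fin N → MvPolynomial (Fin N) ℂ,
        (∀ i, (∑ k, c k * L k i) = 0) → ∀ k, c k = 0) := by
  have hfixer : ∀ H (g : W), g ∈ ReflectionArrangement.fixer W (α H) ↔ ∀ v : Fin N → ℂ,
      (∑ i, α H i * v i) = 0 →
        (↑(g : Matrix.GeneralLinearGroup (Fin N) ℂ) : Matrix (Fin N) (Fin N) ℂ).mulVec v = v :=
    fun H g => Iff.rfl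
  have hne : ∀ H, ∃ g ∈ ReflectionArrangement.fixer W (α H), g ≠ 1 := fun H => by
    obtain ⟨g, hg, hrk, hfix⟩ := hrefl H
    refine ⟨⟨g, hg⟩, (hfixer H _).2 hfix, fun h1 => ?_⟩
    have h2 : g = 1 := congrArg Subtype.val h1
    rw [IsReflection, h2] at hrk
    simp at hrk
  obtain ⟨R, hcoact, hroot, hexpo⟩ := ReflectionArrangement.exists_reflectionSystem (W := W) hα
    hdistinct hne m (fun g H => hminv g g.2 H)
  have hdvd : ∀ H, R.lin H ^ R.expo H = linPoly (α H) ^ (m H * n H) := fun H => by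
    rw [hexpo, hnstab, ReflectionArrangement.ReflectionSystem.lin, hroot]
    rfl
  have hsum : ∑ H, R.expo H = ∑ H, m H * n H := Finset.sum_congr rfl fun H _ => by
    rw [hexpo, hnstab]
    rfl
  have hirr' : ∀ U : Submodule ℂ (Fin N → ℂ),
      (∀ g, ∀ a ∈ U, R.coact g a ∈ U) → U = ⊥ ∨ U = ⊤ := by
    rw [hcoact]
    exact ReflectionArrangement.formRep_irreducible fun U hU =>
      hirr U fun g hg v hv => hU ⟨g, hg⟩ v hv
  obtain ⟨L, d, hd, hL, hhom, hgenL, hind⟩ := R.exists_basis hN hirr'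
  refine ⟨fun k i => L k (Pi.single i 1), d, by rw [hd, hsum], fun k H => ?_,
    fun k i => Or.inr (hhom k _), fun f hf => ?_, hind⟩
  · have h := R.mem_logHom_coact.1 (hL k) H
    rw [hdvd, hroot] at h
    rw [ReflectionArrangement.applyVF_linPoly]
    convert h using 1
    rw [ReflectionArrangement.apply_eq_sum_smul (L k), Fintype.linearCombination_apply]
    simp only [smul_eq_C_mul]
  · obtain ⟨c, hc⟩ := hgenL (Fintype.linearCombination ℂ f) (R.mem_logHom_coact.2 fun H => by
      rw [hdvd, hroot, ← ReflectionArrangement.applyVF_linPoly]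
      exact hf H)
    refine ⟨c, fun i => ?_⟩
    rw [← hc i, Fintype.linearCombination_apply_single, one_smul]

end
end

section
/- Let H ∈ 𝒜 with m_H ≥ 1 and let p ∈ S satisfy α_H^{m_H n_H} ∣ (p − s_H·p). Then α_H^{n_H − 1} divides the directional derivative ∂_{α_H^∨} p. -/
open MvPolynomial

noncomputable section

/-- The derivative of a polynomial in the direction `v`, as a derivation. -/
def dirDeriv {N : ℕ} (v : Fin N → ℂ) :
    Derivation ℂ (MvPolynomial (Fin N) ℂ) (MvPolynomial (Fin N) ℂ) :=
  ∑ i, (C (v i) : MvPolynomial (Fin N) ℂ) • pderiv i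

lemma dirDeriv_apply {N : ℕ} (v : Fin N → ℂ) (p : MvPolynomial (Fin N) ℂ) :
    dirDeriv v p = ∑ i, C (v i) * pderiv i p := by
  have h := map_sum Derivation.coeFnAddMonoidHom
    (fun i => (C (v i) : MvPolynomial (Fin N) ℂ) • pderiv (R := ℂ) i) Finset.univ
  exact (congrFun h p).trans (by simp only [Finset.sum_apply]; rfl)

lemma dirDeriv_X {N : ℕ} (v : Fin N → ℂ) (i : Fin N) : dirDeriv v (X i) = C (v i) := by
  classical
  simp [dirDeriv_apply, pderiv_X, Pi.single_apply]

lemma dirDeriv_C {N : ℕ} (v : Fin N → ℂ) (r : ℂ) : dirDeriv v (C r) = 0 := by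
  simp

lemma dirDeriv_linPoly {N : ℕ} (v a : Fin N → ℂ) :
    dirDeriv v (linPoly a) = C (∑ i, a i * v i) := by
  simp [linPoly, dirDeriv_X]

/-- Substitution of `x + ω α(x) v` for `x`, where `α` is the linear form with coefficients `a`. -/
def transvect {N : ℕ} (ω : ℂ) (a v : Fin N → ℂ) :
    MvPolynomial (Fin N) ℂ →ₐ[ℂ] MvPolynomial (Fin N) ℂ :=
  aeval fun i => X i + C (ω * v i) * linPoly a

lemma transvect_X {N : ℕ} (ω : ℂ) (a v : Fin N → ℂ) (i : Fin N) :
    transvect ω a v (X i) = X i + C (ω * v i) * linPoly a := by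
  simp [transvect]

lemma transvect_C {N : ℕ} (ω : ℂ) (a v : Fin N → ℂ) (r : ℂ) :
    transvect ω a v (C r) = C r := by
  simp [transvect]

lemma transvect_linPoly {N : ℕ} (ω : ℂ) (a v : Fin N → ℂ) :
    transvect ω a v (linPoly a) = C (1 + ω * ∑ i, a i * v i) * linPoly a := by
  conv_lhs => rw [linPoly]
  simp only [map_sum, map_mul, transvect_C, transvect_X, mul_add, Finset.sum_add_distrib]
  rw [map_add, add_mul, map_mul C ω, map_sum, C_1, one_mul, Finset.mul_sum, Finset.sum_mul]
  congr 1
  refine Finset.sum_congr rfl fun i _ => ?_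
  rw [map_mul]
  ring

/-- Modulo the linear form `α`, the substitution is the identity. -/
lemma linPoly_dvd_sub_transvect {N : ℕ} (ω : ℂ) (a v : Fin N → ℂ)
    (p : MvPolynomial (Fin N) ℂ) : linPoly a ∣ p - transvect ω a v p := by
  induction p using MvPolynomial.induction_on with
  | C r => simp
  | add p q hp hq =>
    rw [map_add, add_sub_add_comm]
    exact dvd_add hp hq
  | mul_X p i hp =>
    rw [map_mul, transvect_X]
    have : p * X i - transvect ω a v p * (X i + C (ω * v i) * linPoly a)
        = (p - transvect ω a v p) * X i
          - linPoly a * (transvect ω a v p * C (ω * v i)) := by ring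
    rw [this]
    exact dvd_sub (hp.mul_right _) (dvd_mul_right _ _)

lemma dirDeriv_transvect {N : ℕ} (ω : ℂ) (a v : Fin N → ℂ) (p : MvPolynomial (Fin N) ℂ) :
    dirDeriv v (transvect ω a v p)
      = C (1 + ω * ∑ i, a i * v i) * transvect ω a v (dirDeriv v p) := by
  induction p using MvPolynomial.induction_on with
  | C r => simp
  | add p q hp hq => simp only [map_add, hp, hq, mul_add]
  | mul_X p i hp =>
    simp only [map_mul, Derivation.leibniz, hp, smul_eq_mul, transvect_X, map_add, dirDeriv_X,
      dirDeriv_C, dirDeriv_linPoly, transvect_C, C_1]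
    ring

/-- If `g ≡ μ · σ g` modulo `α ^ n`, where `σ α = μ α` and no `μ ^ j` with `1 ≤ j ≤ n` is `1`,
then `α ^ n` divides `g`. -/
lemma linPoly_pow_dvd {N : ℕ} {ω μ : ℂ} {a v : Fin N → ℂ} (ha : linPoly a ≠ 0)
    (hμ : 1 + ω * ∑ i, a i * v i = μ) {n : ℕ} (hroot : ∀ j, 0 < j → j ≤ n → μ ^ j ≠ 1)
    {g : MvPolynomial (Fin N) ℂ} (hg : linPoly a ^ n ∣ g - C μ * transvect ω a v g) :
    linPoly a ^ n ∣ g := by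
  suffices ∀ k ≤ n, linPoly a ^ k ∣ g from this n le_rfl
  intro k
  induction k with
  | zero => simp
  | succ k ih =>
    intro hk
    obtain ⟨h, rfl⟩ := ih (by omega)
    rw [pow_succ]
    refine mul_dvd_mul_left _ ?_
    have h1 : linPoly a ^ k * h - C μ * transvect ω a v (linPoly a ^ k * h)
        = linPoly a ^ k * (h - C (μ ^ (k + 1)) * transvect ω a v h) := by
      rw [map_mul, map_pow, transvect_linPoly, hμ, map_pow]
      ring
    have h2 : linPoly a ∣ h - C (μ ^ (k + 1)) * transvect ω a v h := by
      have := (pow_dvd_pow (linPoly a) hk).trans hg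
      rwa [h1, pow_succ, mul_dvd_mul_iff_left (pow_ne_zero _ ha)] at this
    have h3 : linPoly a ∣ C (1 - μ ^ (k + 1)) * h := by
      have := dvd_sub h2 ((linPoly_dvd_sub_transvect ω a v h).mul_left (C (μ ^ (k + 1))))
      convert this using 1
      rw [map_sub, C_1]
      ring
    have h4 : IsUnit (C (1 - μ ^ (k + 1)) : MvPolynomial (Fin N) ℂ) :=
      (IsUnit.mk0 _ (sub_ne_zero.2 (hroot _ k.succ_pos hk).symm)).map C
    exact h4.dvd_mul_left.1 h3

/-- The powers of the reflection `x ↦ x - α(x) v`. -/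
lemma reflection_pow_mulVec {N : ℕ} {M : Matrix (Fin N) (Fin N) ℂ} {a v : Fin N → ℂ}
    (hM : ∀ x : Fin N → ℂ, M.mulVec x = x - (∑ i, a i * x i) • v) (k : ℕ) (x : Fin N → ℂ) :
    (M ^ k).mulVec x
      = x - ((∑ j ∈ Finset.range k, (1 - ∑ i, a i * v i) ^ j) * ∑ i, a i * x i) • v := by
  induction k with
  | zero => simp
  | succ k ih =>
    rw [pow_succ', ← Matrix.mulVec_mulVec, ih, hM, geom_sum_succ]
    ext l
    simp only [Pi.sub_apply, Pi.smul_apply, smul_eq_mul, mul_sub, Finset.sum_sub_distrib]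
    have : ∀ t : ℂ, ∑ i, a i * (t * v i) = t * ∑ i, a i * v i := fun t => by
      rw [Finset.mul_sum]
      exact Finset.sum_congr rfl fun i _ => by ring
    rw [this]
    ring

/-- A reflection `x ↦ x - α(x) v` is of order `n` only if `1 - α(v)` is a primitive `n`-th root
of unity different from `1`. -/
lemma reflection_eigenvalue {N : ℕ} {s : Matrix.GeneralLinearGroup (Fin N) ℂ}
    {a v : Fin N → ℂ} (ha : a ≠ 0) (hv : v ≠ 0)
    (hs : ∀ x : Fin N → ℂ,
      (↑s : Matrix (Fin N) (Fin N) ℂ).mulVec x = x - (∑ i, a i * x i) • v)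
    (hpos : 0 < orderOf s) :
    (∑ i, a i * v i) ≠ 0 ∧ IsPrimitiveRoot (1 - ∑ i, a i * v i) (orderOf s) := by
  have key (k : ℕ) : s ^ k = 1 ↔ ∑ j ∈ Finset.range k, (1 - ∑ i, a i * v i) ^ j = 0 := by
    constructor
    · intro h
      obtain ⟨i, hi⟩ := Function.ne_iff.1 ha
      obtain ⟨l, hl⟩ := Function.ne_iff.1 hv
      have h1 := reflection_pow_mulVec hs k (Pi.single i 1)
      rw [← Units.val_pow_eq_pow_val, h, Units.val_one, Matrix.one_mulVec] at h1
      have h2 := congrFun h1 l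
      rw [Pi.sub_apply, eq_comm, sub_eq_self] at h2
      simp only [Pi.smul_apply, smul_eq_mul, Pi.single_apply, mul_ite, mul_one, mul_zero,
        Finset.sum_ite_eq', Finset.mem_univ, if_true, mul_eq_zero] at h2
      exact (h2.resolve_right hl).resolve_right hi
    · intro h
      refine Units.ext (Matrix.mulVec_injective (funext fun x => ?_))
      rw [Units.val_pow_eq_pow_val, reflection_pow_mulVec hs, h]
      simp
  have hc : (∑ i, a i * v i) ≠ 0 := by
    intro hc
    have := (key (orderOf s)).1 (pow_orderOf_eq_one s)
    simp only [hc, sub_zero, one_pow, Finset.sum_const, Finset.card_range, nsmul_eq_mul, mul_one,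
      Nat.cast_eq_zero] at this
    omega
  refine ⟨hc, ?_, fun l hl => ?_⟩
  · have h := (key _).1 (pow_orderOf_eq_one s)
    have := geom_sum_mul (1 - ∑ i, a i * v i) (orderOf s)
    rw [h, zero_mul] at this
    exact (sub_eq_zero.1 this.symm)
  · refine orderOf_dvd_of_pow_eq_one ((key l).2 ?_)
    have := geom_sum_mul (1 - ∑ i, a i * v i) l
    rw [hl, sub_self, mul_eq_zero] at this
    exact this.resolve_right (by simpa using hc)

/-- The action of a reflection on polynomials, with the inverse made explicit. -/
lemma polyAct_reflection {N : ℕ} {s : Matrix.GeneralLinearGroup (Fin N) ℂ}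
    {a v : Fin N → ℂ} (hv : 1 - ∑ i, a i * v i ≠ 0)
    (hs : ∀ x : Fin N → ℂ,
      (↑s : Matrix (Fin N) (Fin N) ℂ).mulVec x = x - (∑ i, a i * x i) • v)
    (p : MvPolynomial (Fin N) ℂ) :
    polyAct s p = transvect (1 - ∑ i, a i * v i)⁻¹ a v p := by
  set ω := (1 - ∑ i, a i * v i)⁻¹ with hω
  have hmul : (↑s : Matrix (Fin N) (Fin N) ℂ) * (1 + ω • Matrix.vecMulVec v a) = 1 := by
    refine Matrix.mulVec_injective (funext fun x => ?_)
    have hx : (1 + ω • Matrix.vecMulVec v a).mulVec x = x + (ω * ∑ i, a i * x i) • v := by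
      ext l
      simp [Matrix.add_mulVec, Matrix.smul_mulVec, Matrix.vecMulVec_mulVec, dotProduct]
      ring
    rw [← Matrix.mulVec_mulVec, hx, Matrix.mulVec_add, Matrix.mulVec_smul, hs, hs,
      Matrix.one_mulVec]
    ext l
    simp only [Pi.sub_apply, Pi.add_apply, Pi.smul_apply, smul_eq_mul]
    have : ω * (1 - ∑ i, a i * v i) = 1 := inv_mul_cancel₀ hv
    linear_combination (∑ i, a i * x i) * v l * this
  have hinv : (↑(s⁻¹) : Matrix (Fin N) (Fin N) ℂ) = 1 + ω • Matrix.vecMulVec v a :=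
    Units.inv_eq_of_mul_eq_one_right hmul
  unfold polyAct polyActM transvect
  rw [hinv]
  congr 2
  ext1 i
  simp [Matrix.one_apply, Matrix.vecMulVec_apply, add_mul, Finset.sum_add_distrib, linPoly,
    Finset.mul_sum, mul_assoc]

/-- for `H ∈ 𝒜` with `m_H ≥ 1` and `p` satisfying
`α_H^{m_H n_H} ∣ p - s_H·p`, the directional derivative `∂_{α_H^∨} p` is divisible by
`α_H^{n_H - 1}`. -/
theorem stmt_9 (N : ℕ) (hN : 0 < N)
    -- the generator `s_H` of the cyclic pointwise stabilizer `W_H`, of order `n_H ≥ 2`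
    (sH : Matrix.GeneralLinearGroup (Fin N) ℂ)
    (nH : ℕ) (hn2 : 2 ≤ nH) (horder : orderOf sH = nH)
    -- `α_H` and `α_H^∨` with `s_H v = v - α_H(v) α_H^∨`
    (a : Fin N → ℂ) (ha : a ≠ 0)
    (av : Fin N → ℂ) (hav : av ≠ 0)
    (hform : ∀ v : Fin N → ℂ,
      (↑sH : Matrix (Fin N) (Fin N) ℂ).mulVec v = v - (∑ i, a i * v i) • av)
    -- the multiplicity `m_H ≥ 1`
    (mH : ℕ) (hm : 1 ≤ mH)
    (p : MvPolynomial (Fin N) ℂ)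
    (hp : linPoly a ^ (mH * nH) ∣ p - polyAct sH p) :
    linPoly a ^ (nH - 1) ∣ ∑ i, MvPolynomial.C (av i) * MvPolynomial.pderiv i p := by
  obtain ⟨hc, hζ⟩ := reflection_eigenvalue ha hav hform (by omega)
  rw [horder] at hζ
  have hζ0 := hζ.ne_zero (by omega)
  rw [polyAct_reflection hζ0 hform] at hp
  set ζ := 1 - ∑ i, a i * av i with hζdef
  have hμ : 1 + ζ⁻¹ * ∑ i, a i * av i = ζ⁻¹ := by
    have : ∑ i, a i * av i = 1 - ζ := by rw [hζdef]; ring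
    rw [this]
    field_simp
    ring
  have hlin : linPoly a ≠ 0 := by
    intro h
    have := dirDeriv_linPoly av a
    rw [h, map_zero, eq_comm, map_eq_zero_iff C (C_injective _ _)] at this
    exact hc this
  rw [← dirDeriv_apply]
  refine linPoly_pow_dvd hlin hμ (fun j hj hjn => hζ.inv.pow_ne_one_of_pos_of_lt hj.ne' (by omega))
    ?_
  obtain ⟨q, hq⟩ := (pow_dvd_pow (linPoly a) (Nat.le_mul_of_pos_left nH hm)).trans hp
  have hσ := dirDeriv_transvect ζ⁻¹ a av p
  rw [hμ] at hσ
  rw [← hσ, ← map_sub, hq, Derivation.leibniz, Derivation.leibniz_pow]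
  simp only [smul_eq_mul, nsmul_eq_mul]
  exact dvd_add ((pow_dvd_pow _ (Nat.sub_le _ _)).mul_right _)
    ((((dvd_mul_right _ _).mul_left _)).mul_left _)

end
end

section
/- Let L = Σ_{i=1}^N a_i ∂_{x_i} (a_i ∈ S) be a W-invariant polynomial vector field. Then L ∈ D(Cat), i.e. ((α,x) − j) divides L((α,x)) = Σ_i α_i a_i for every α ∈ R_+ and every integer j with −m_α ≤ j ≤ m_α, if and only if a_i ∈ Q_m^{tr} for all 1 ≤ i ≤ N. -/
open MvPolynomial

noncomputable section

/-- Complexification of a real vector. -/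
def cplx {N : ℕ} (a : Fin N → ℝ) : Fin N → ℂ := fun i => (a i : ℂ)

/-- The (complexified) matrix of the orthogonal reflection `s_a(x) = x - (a,x) a^∨`. -/
def reflM {N : ℕ} (a : Fin N → ℝ) : Matrix (Fin N) (Fin N) ℂ :=
  1 - Matrix.of (fun i j => (2 / (∑ k, (a k : ℂ) ^ 2)) * (a i : ℂ) * (a j : ℂ))

/-- Substitution `x ↦ x + v` on polynomials. -/
def shiftPoly {N : ℕ} (v : Fin N → ℂ) (p : MvPolynomial (Fin N) ℂ) :
    MvPolynomial (Fin N) ℂ :=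
  MvPolynomial.aeval (fun i => MvPolynomial.X i + MvPolynomial.C (v i)) p

/-- The vector `½·j·a^∨ = j·a/(a,a)`. -/
def halfCovec {N : ℕ} (a : Fin N → ℝ) (j : ℕ) : Fin N → ℂ :=
  fun i => (j : ℂ) * (a i : ℂ) / (∑ k, (a k : ℂ) ^ 2)

lemma eval_linPoly {N : ℕ} (a x : Fin N → ℂ) :
    eval x (linPoly a) = ∑ i, a i * x i := by
  simp [linPoly]

lemma eval_shiftPoly {N : ℕ} (v x : Fin N → ℂ) (p : MvPolynomial (Fin N) ℂ) :
    eval x (shiftPoly v p) = eval (x + v) p := by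
  have h : (eval x).comp (aeval (R := ℂ) fun i => X i + C (v i) :
      MvPolynomial (Fin N) ℂ →ₐ[ℂ] MvPolynomial (Fin N) ℂ).toRingHom = eval (x + v) := by
    apply MvPolynomial.ringHom_ext <;> intros <;> simp
  exact congrArg (fun g => g p) h

lemma eval_polyActM {N : ℕ} (M : Matrix (Fin N) (Fin N) ℂ) (x : Fin N → ℂ)
    (p : MvPolynomial (Fin N) ℂ) :
    eval x (polyActM M p) = eval (M.mulVec x) p := by
  have h : (eval x).comp (aeval (R := ℂ) fun i => ∑ j, C (M i j) * X j :
      MvPolynomial (Fin N) ℂ →ₐ[ℂ] MvPolynomial (Fin N) ℂ).toRingHom = eval (M.mulVec x) := by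
    apply MvPolynomial.ringHom_ext <;> intros <;> simp [Matrix.mulVec, dotProduct]
  exact congrArg (fun g => g p) h

/-- A polynomial is divisible by `(a,x) - c` iff it vanishes on the hyperplane `(a,x) = c`. -/
lemma linPoly_sub_C_dvd_iff {N : ℕ} (a : Fin N → ℂ) (ha : ∑ i, a i ^ 2 ≠ 0) (c : ℂ)
    (p : MvPolynomial (Fin N) ℂ) :
    linPoly a - C c ∣ p ↔ ∀ x : Fin N → ℂ, ∑ i, a i * x i = c → eval x p = 0 := by
  constructor
  · rintro ⟨q, rfl⟩ x hx
    simp [eval_linPoly, hx]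
  · intro h
    let φ : MvPolynomial (Fin N) ℂ →ₐ[ℂ] MvPolynomial (Fin N) ℂ :=
      aeval fun i => X i - (linPoly a - C c) * C (a i / ∑ k, a k ^ 2)
    have hφ : φ p = 0 := by
      apply MvPolynomial.funext
      intro x
      let y : Fin N → ℂ := fun i => x i - (∑ k, a k * x k - c) * (a i / ∑ k, a k ^ 2)
      have hcomp : (eval x).comp φ.toRingHom = eval y := by
        apply MvPolynomial.ringHom_ext <;> intros <;> simp [φ, y, eval_linPoly]
      have hy : ∑ i, a i * y i = c := by
        have h1 : ∀ i, a i * y i =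
            a i * x i - (∑ k, a k * x k - c) / (∑ k, a k ^ 2) * a i ^ 2 := by
          intro i
          simp only [y]
          ring
        simp_rw [h1]
        rw [Finset.sum_sub_distrib, ← Finset.mul_sum, div_mul_cancel₀ _ ha]
        ring
      calc eval x (φ p) = eval y p := congrArg (fun g => g p) hcomp
        _ = eval x 0 := by rw [h y hy, map_zero]
    let I : Ideal (MvPolynomial (Fin N) ℂ) := Ideal.span {linPoly a - C c}
    have hI : (Ideal.Quotient.mkₐ ℂ I).comp φ = Ideal.Quotient.mkₐ ℂ I := by
      apply MvPolynomial.algHom_ext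
      intro i
      have h0 : (Ideal.Quotient.mkₐ ℂ I) (linPoly a - C c) = 0 :=
        Ideal.Quotient.eq_zero_iff_mem.mpr (Ideal.mem_span_singleton_self _)
      simp only [φ, AlgHom.comp_apply, aeval_X]
      rw [map_sub, map_mul, h0, zero_mul, sub_zero]
    have hp : (Ideal.Quotient.mkₐ ℂ I) p = 0 := by
      rw [← hI, AlgHom.comp_apply, hφ, map_zero]
    exact Ideal.mem_span_singleton.mp (Ideal.Quotient.eq_zero_iff_mem.mp hp)

lemma linPoly_dvd_iff {N : ℕ} (a : Fin N → ℂ) (ha : ∑ i, a i ^ 2 ≠ 0)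
    (p : MvPolynomial (Fin N) ℂ) :
    linPoly a ∣ p ↔ ∀ x : Fin N → ℂ, ∑ i, a i * x i = 0 → eval x p = 0 := by
  simpa using linPoly_sub_C_dvd_iff a ha 0 p

lemma sum_cplx_sq_ne_zero {N : ℕ} {a : Fin N → ℝ} (ha : a ≠ 0) :
    ∑ k, (a k : ℂ) ^ 2 ≠ 0 := by
  intro h
  have h' : ∑ k, a k ^ 2 = 0 := by exact_mod_cast h
  rw [Finset.sum_eq_zero_iff_of_nonneg fun i _ => sq_nonneg _] at h'
  exact ha (funext fun i => by simpa using h' i (Finset.mem_univ i))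

lemma reflM_mulVec {N : ℕ} (a : Fin N → ℝ) (x : Fin N → ℂ) (i : Fin N) :
    (reflM a).mulVec x i =
      x i - 2 / (∑ k, (a k : ℂ) ^ 2) * a i * ∑ k, (a k : ℂ) * x k := by
  rw [reflM, Matrix.sub_mulVec, Matrix.one_mulVec, Pi.sub_apply, Finset.mul_sum]
  simp only [Matrix.mulVec, dotProduct, Matrix.of_apply, mul_assoc]

/-- The components of a vector field invariant under `s_a` satisfy `f(y) = s_a f(s_a y)`. -/
lemma eval_eq_of_invariant {N : ℕ} (a : Fin N → ℝ) (f : Fin N → MvPolynomial (Fin N) ℂ)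
    (hinv : ∀ p : MvPolynomial (Fin N) ℂ,
      polyActM (reflM a) (applyVF f (polyActM (reflM a) p)) = applyVF f p)
    (y : Fin N → ℂ) (i : Fin N) :
    eval y (f i) = eval ((reflM a).mulVec y) (f i) -
      2 / (∑ k, (a k : ℂ) ^ 2) * a i *
        ∑ k, (a k : ℂ) * eval ((reflM a).mulVec y) (f k) := by
  have h := congrArg (eval y) (hinv (X i))
  rw [eval_polyActM] at h
  have h1 : applyVF f (X i) = f i := by
    simp [applyVF, pderiv_X, Pi.single_apply]
  have h2 : applyVF f (polyActM (reflM a) (X i)) = ∑ k, C (reflM a i k) * f k := by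
    simp [applyVF, polyActM, pderiv_X, Pi.single_apply, mul_comm]
  rw [h1, h2] at h
  rw [← h, ← reflM_mulVec a (fun k => eval ((reflM a).mulVec y) (f k)) i]
  simp [Matrix.mulVec, dotProduct]

lemma sum_mul_eval_reflM {N : ℕ} (a : Fin N → ℝ) (ha : a ≠ 0)
    (f : Fin N → MvPolynomial (Fin N) ℂ)
    (hinv : ∀ p : MvPolynomial (Fin N) ℂ,
      polyActM (reflM a) (applyVF f (polyActM (reflM a) p)) = applyVF f p)
    (y : Fin N → ℂ) :
    ∑ k, (a k : ℂ) * eval y (f k) =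
      -∑ k, (a k : ℂ) * eval ((reflM a).mulVec y) (f k) := by
  have hq := sum_cplx_sq_ne_zero ha
  set g := ∑ k, (a k : ℂ) * eval ((reflM a).mulVec y) (f k) with hg
  have h1 : ∀ k, (a k : ℂ) * eval y (f k) = (a k : ℂ) * eval ((reflM a).mulVec y) (f k) -
      2 / (∑ k, (a k : ℂ) ^ 2) * g * (a k : ℂ) ^ 2 := by
    intro k
    rw [eval_eq_of_invariant a f hinv y k]
    ring
  simp_rw [h1]
  rw [Finset.sum_sub_distrib, ← Finset.mul_sum, ← hg]
  field_simp
  ring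

lemma sum_mul_reflM_mulVec {N : ℕ} (a : Fin N → ℝ) (ha : a ≠ 0) (y : Fin N → ℂ) :
    ∑ k, (a k : ℂ) * (reflM a).mulVec y k = -∑ k, (a k : ℂ) * y k := by
  have hq := sum_cplx_sq_ne_zero ha
  simp_rw [reflM_mulVec]
  set g := ∑ k, (a k : ℂ) * y k with hg
  have h1 : ∀ k, (a k : ℂ) * (y k - 2 / (∑ k, (a k : ℂ) ^ 2) * a k * g) =
      (a k : ℂ) * y k - 2 / (∑ k, (a k : ℂ) ^ 2) * g * (a k : ℂ) ^ 2 := by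
    intro k
    ring
  simp_rw [h1]
  rw [Finset.sum_sub_distrib, ← Finset.mul_sum, ← hg]
  field_simp
  ring

lemma sum_mul_halfCovec {N : ℕ} (a : Fin N → ℝ) (ha : a ≠ 0) (j : ℕ) :
    ∑ k, (a k : ℂ) * halfCovec a j k = j := by
  have hq := sum_cplx_sq_ne_zero ha
  have h1 : ∀ k, (a k : ℂ) * halfCovec a j k = j / (∑ k, (a k : ℂ) ^ 2) * (a k : ℂ) ^ 2 := by
    intro k
    simp only [halfCovec]
    ring
  simp_rw [h1]
  rw [← Finset.mul_sum, div_mul_cancel₀ _ hq]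

lemma reflM_mulVec_sub_halfCovec {N : ℕ} (a : Fin N → ℝ) (ha : a ≠ 0) (j : ℕ) (x : Fin N → ℂ)
    (hx : ∑ k, (a k : ℂ) * x k = 0) :
    (reflM a).mulVec (x - halfCovec a j) = x + halfCovec a j := by
  funext i
  rw [reflM_mulVec]
  have h : ∑ k, (a k : ℂ) * (x - halfCovec a j) k = -j := by
    simp only [Pi.sub_apply, mul_sub, Finset.sum_sub_distrib, hx, sum_mul_halfCovec a ha j,
      zero_sub]
  rw [h]
  simp only [Pi.sub_apply, Pi.add_apply, halfCovec]
  ring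

/-- The difference of the two shifts of `f i` at a point of the mirror of `a`, in terms of the
value of `(a,f)` on the shifted mirror. -/
lemma eval_shiftPoly_sub {N : ℕ} (a : Fin N → ℝ) (ha : a ≠ 0)
    (f : Fin N → MvPolynomial (Fin N) ℂ)
    (hinv : ∀ p : MvPolynomial (Fin N) ℂ,
      polyActM (reflM a) (applyVF f (polyActM (reflM a) p)) = applyVF f p)
    (j : ℕ) (x : Fin N → ℂ) (hx : ∑ k, (a k : ℂ) * x k = 0) (i : Fin N) :
    eval x (shiftPoly (halfCovec a j) (f i) - shiftPoly (-(halfCovec a j)) (f i)) =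
      2 / (∑ k, (a k : ℂ) ^ 2) * a i * ∑ k, (a k : ℂ) * eval (x + halfCovec a j) (f k) := by
  rw [map_sub, eval_shiftPoly, eval_shiftPoly, ← sub_eq_add_neg,
    eval_eq_of_invariant a f hinv (x - halfCovec a j), reflM_mulVec_sub_halfCovec a ha j x hx]
  ring

/-- a `W`-invariant polynomial vector field `L = Σ a_i ∂_i` lies in `D(Cat)`
(that is, `((α,x) − j) ∣ L((α,x))` for every positive root `α` and `|j| ≤ m_α`) if and only
if all its components lie in the trigonometric quasi-invariants `Q_m^{tr}`. -/
theorem stmt_11 (N : ℕ) (hN : 0 < N)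
    -- `R` is a reduced crystallographic root system spanning `ℝ^N`
    (R : Finset (Fin N → ℝ)) (hR0 : (0 : Fin N → ℝ) ∉ R)
    (hspan : Submodule.span ℝ (R : Set (Fin N → ℝ)) = ⊤)
    (hreduced : ∀ a ∈ R, ∀ c : ℝ, c • a ∈ R → c = 1 ∨ c = -1)
    (hrefl : ∀ a ∈ R, ∀ b ∈ R,
      (b - (2 * (∑ i, a i * b i) / (∑ i, a i * a i)) • a) ∈ R)
    (hcrys : ∀ a ∈ R, ∀ b ∈ R, ∃ k : ℤ,
      2 * (∑ i, a i * b i) / (∑ i, b i * b i) = (k : ℝ))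
    -- `R_+` is a choice of positive roots
    (Rp : Finset (Fin N → ℝ))
    (hRp : ∀ a, a ∈ R ↔ (a ∈ Rp ∨ -a ∈ Rp)) (hRpdisj : ∀ a, ¬(a ∈ Rp ∧ -a ∈ Rp))
    -- `m` is a `W`-invariant multiplicity function
    (m : (Fin N → ℝ) → ℕ)
    (hminv : ∀ a ∈ R, ∀ b ∈ R,
      m (b - (2 * (∑ i, a i * b i) / (∑ i, a i * a i)) • a) = m b)
    -- a vector field `L = Σ a_i ∂_i`, invariant under the Weyl group `W`
    -- (equivalently, under each of the generating reflections `s_α`, `α ∈ R`)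
    (f : Fin N → MvPolynomial (Fin N) ℂ)
    (hinv : ∀ a ∈ R, ∀ p : MvPolynomial (Fin N) ℂ,
      polyActM (reflM a) (applyVF f (polyActM (reflM a) p)) = applyVF f p) :
    -- `L ∈ D(Cat)` ...
    (∀ a ∈ Rp, ∀ j : ℤ, -(m a : ℤ) ≤ j → j ≤ (m a : ℤ) →
      (linPoly (cplx a) - MvPolynomial.C (j : ℂ)) ∣ ∑ i, MvPolynomial.C ((a i : ℝ) : ℂ) * f i)
    ↔
    -- ... iff every component of `L` is a trigonometric quasi-invariant
    (∀ i, ∀ a ∈ R, ∀ j : ℕ, 1 ≤ j → j ≤ m a →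
      linPoly (cplx a) ∣
        shiftPoly (halfCovec a j) (f i) - shiftPoly (-(halfCovec a j)) (f i)) := by
  have hne : ∀ a ∈ R, a ≠ 0 := fun a ha h => hR0 (h ▸ ha)
  have hmneg : ∀ a ∈ R, m (-a) = m a := by
    intro a ha
    have hq : ∑ i, a i * a i ≠ 0 := by
      intro h
      apply sum_cplx_sq_ne_zero (hne a ha)
      simp_rw [pow_two]
      exact_mod_cast h
    have h := hminv a ha a ha
    rw [mul_div_assoc, div_self hq, mul_one, two_smul, sub_add_cancel_left] at h
    exact h
  have hdvd : ∀ a ∈ R, ∀ j : ℤ,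
      ((linPoly (cplx a) - MvPolynomial.C (j : ℂ)) ∣
          ∑ i, MvPolynomial.C ((a i : ℝ) : ℂ) * f i) ↔
        ∀ y : Fin N → ℂ, ∑ k, (a k : ℂ) * y k = j → ∑ k, (a k : ℂ) * eval y (f k) = 0 := by
    intro a ha j
    rw [linPoly_sub_C_dvd_iff (cplx a) (sum_cplx_sq_ne_zero (hne a ha))]
    simp [cplx]
  constructor
  · intro h i a ha j _ hjm
    rw [linPoly_dvd_iff (cplx a) (sum_cplx_sq_ne_zero (hne a ha))]
    intro x hx
    rw [eval_shiftPoly_sub a (hne a ha) f (hinv a ha) j x hx]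
    have hy : ∑ k, (a k : ℂ) * (x + halfCovec a j) k = j := by
      have hx' : ∑ k, (a k : ℂ) * x k = 0 := hx
      simp only [Pi.add_apply, mul_add, Finset.sum_add_distrib, hx',
        sum_mul_halfCovec a (hne a ha) j, zero_add]
    suffices hs : ∑ k, (a k : ℂ) * eval (x + halfCovec a j) (f k) = 0 by rw [hs, mul_zero]
    rcases (hRp a).mp ha with hp | hp
    · exact (hdvd a ha j).mp (h a hp j (by omega) (by omega)) _ (by simpa using hy)
    · have hna : -a ∈ R := (hRp (-a)).mpr (Or.inl hp)
      have hm := hmneg a ha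
      have := (hdvd (-a) hna (-j)).mp (h (-a) hp (-j) (by omega) (by omega))
        (x + halfCovec a j) (by simpa using hy)
      simpa using this
  · intro h a hp j hj1 hj2
    have ha : a ∈ R := (hRp a).mpr (Or.inl hp)
    rw [hdvd a ha]
    have hnat : ∀ n : ℕ, n ≤ m a → ∀ y : Fin N → ℂ, ∑ k, (a k : ℂ) * y k = n →
        ∑ k, (a k : ℂ) * eval y (f k) = 0 := by
      intro n hn y hy
      rcases Nat.eq_zero_or_pos n with rfl | hpos
      · have hfix : (reflM a).mulVec y = y := by
          funext i
          rw [reflM_mulVec, hy]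
          simp
        have hg := sum_mul_eval_reflM a (hne a ha) f (hinv a ha) y
        rw [hfix] at hg
        exact self_eq_neg.mp hg
      · obtain ⟨i, hi⟩ := Function.ne_iff.mp (hne a ha)
        have hx : ∑ k, (a k : ℂ) * (y - halfCovec a n) k = 0 := by
          simp only [Pi.sub_apply, mul_sub, Finset.sum_sub_distrib, hy,
            sum_mul_halfCovec a (hne a ha) n, sub_self]
        have h0 := (linPoly_dvd_iff (cplx a) (sum_cplx_sq_ne_zero (hne a ha)) _).mp
          (h i a ha n hpos hn) (y - halfCovec a n) hx
        rw [eval_shiftPoly_sub a (hne a ha) f (hinv a ha) n _ hx, sub_add_cancel] at h0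
        refine (mul_eq_zero.mp h0).resolve_left (mul_ne_zero (div_ne_zero two_ne_zero
          (sum_cplx_sq_ne_zero (hne a ha))) ?_)
        exact_mod_cast hi
    intro y hy
    obtain ⟨n, rfl | rfl⟩ := j.eq_nat_or_neg
    · exact hnat n (by omega) y (by simpa using hy)
    · rw [sum_mul_eval_reflM a (hne a ha) f (hinv a ha) y,
        hnat n (by omega) _ (by rw [sum_mul_reflM_mulVec a (hne a ha), hy]; simp), neg_zero]

end
end
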